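/- arXiv:1911.08102 — 13 statements merged into one kernel-verified Lean document; each statement's English description precedes it below -/
import Mathlib

section
/- Let G be a finite simple graph (no self-loops). Then the number of perfect matchings of G is even if and only if there exists a nonempty channel in G, i.e., a nonempty set C of vertices such that every vertex of G has an even number of neighbors in C. -/
/-- The number of perfect matchings of a graph `G`. -/
noncomputable def matchCount {V : Type*} (G : SimpleGraph V) : ℕ :=
  Nat.card {M : G.Subgraph // M.IsPerfectMatching}

/-- A channel of `G` is a set `C` of vertices such that every vertex of `G`
has an even number of neighbors in `C`. -/
def IsChannel {V : Type*} (G : SimpleGraph V) (C : Set V) : Prop :=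
  ∀ v : V, Even {w | w ∈ C ∧ G.Adj v w}.ncard

/-- The perfect matching whose edges are the orbits of an involution moving each vertex to a
neighbor. -/
def SimpleGraph.subgraphOfInvolution {V : Type*} (G : SimpleGraph V) (σ : Equiv.Perm V)
    (hσ : σ⁻¹ = σ) (hG : ∀ v, G.Adj (σ v) v) : G.Subgraph where
  verts := Set.univ
  Adj v w := σ v = w
  adj_sub := by
    rintro v _ rfl
    exact (hG v).symm
  edge_vert _ := Set.mem_univ _
  symm := ⟨fun v w h => by rw [← h, ← Equiv.Perm.eq_inv_iff_eq, hσ]⟩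

/-- Perfect matchings correspond to involutions moving each vertex to a neighbor. -/
theorem matchCount_eq_card_involutions {V : Type*} (G : SimpleGraph V) :
    matchCount G = Nat.card {σ : Equiv.Perm V // σ⁻¹ = σ ∧ ∀ v, G.Adj (σ v) v} := by
  symm
  refine Nat.card_congr (Equiv.ofBijective
    (fun σ => ⟨G.subgraphOfInvolution σ.1 σ.2.1 σ.2.2,
      SimpleGraph.Subgraph.isPerfectMatching_iff.2 fun v =>
        ⟨σ.1 v, rfl, fun _ h => Eq.symm h⟩⟩) ⟨?_, ?_⟩)
  · intro σ τ h
    ext v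
    have hadj := congrArg (fun M => M.1.Adj v (τ.1 v)) h
    exact hadj.mpr rfl
  · rintro ⟨M, hM⟩
    choose f hf huniq using SimpleGraph.Subgraph.isPerfectMatching_iff.1 hM
    have hinv : Function.Involutive f := fun v => (huniq (f v) v (hf v).symm).symm
    refine ⟨⟨hinv.toPerm, rfl, fun v => (hf v).adj_sub.symm⟩, Subtype.ext ?_⟩
    ext v w
    · simp [SimpleGraph.subgraphOfInvolution, hM.2 v]
    · change f v = w ↔ M.Adj v w
      exact ⟨fun h => h ▸ hf v, fun h => (huniq v w h).symm⟩

/-- Over a commutative ring of characteristic two, a symmetric determinant only sees involutions. -/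
theorem Matrix.IsSymm.det_eq_sum_involutions {n R : Type*} [Fintype n] [DecidableEq n]
    [CommRing R] [CharP R 2] {A : Matrix n n R} (hA : A.IsSymm) :
    A.det = ∑ σ : Equiv.Perm n with σ⁻¹ = σ, ∏ i, A (σ i) i := by
  have hdet : A.det = ∑ σ : Equiv.Perm n, ∏ i, A (σ i) i := by
    rw [Matrix.det_apply]
    refine Finset.sum_congr rfl fun σ _ => ?_
    rcases Int.units_eq_one_or (Equiv.Perm.sign σ) with h | h <;>
      simp [h, CharTwo.neg_eq]
  have hprod (σ : Equiv.Perm n) : ∏ i, A (σ⁻¹ i) i = ∏ i, A (σ i) i := by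
    rw [← Equiv.prod_comp σ]
    exact Finset.prod_congr rfl fun i _ => by rw [Equiv.Perm.inv_def, Equiv.symm_apply_apply, hA.apply]
  rw [hdet, ← Finset.sum_filter_add_sum_filter_not _ (fun σ : Equiv.Perm n => σ⁻¹ = σ),
    add_eq_left]
  refine Finset.sum_involution (fun σ _ => σ⁻¹) (fun σ _ => ?_) (fun σ hσ _ => ?_)
    (fun σ hσ => ?_) (fun σ _ => inv_inv σ)
  · rw [hprod, CharTwo.add_self_eq_zero]
  · exact (Finset.mem_filter.1 hσ).2
  · simpa [eq_comm] using hσ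

/-- The number of perfect matchings has the parity of the determinant of the adjacency matrix. -/
theorem matchCount_cast_eq_det_adjMatrix {V : Type*} [Fintype V] [DecidableEq V]
    (G : SimpleGraph V) [DecidableRel G.Adj] :
    (matchCount G : ZMod 2) = (G.adjMatrix (ZMod 2)).det := by
  rw [(G.isSymm_adjMatrix).det_eq_sum_involutions, matchCount_eq_card_involutions,
    Nat.card_eq_fintype_card, Fintype.card_subtype, ← Finset.filter_filter,
    Finset.natCast_card_filter]
  exact Finset.sum_congr rfl fun σ _ => by
    simp [SimpleGraph.adjMatrix_apply, Finset.prod_ite_zero]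

/-- A set is a channel iff its indicator vector lies in the kernel of the adjacency matrix. -/
theorem isChannel_iff_adjMatrix_mulVec_eq_zero {V : Type*} [Fintype V]
    (G : SimpleGraph V) [DecidableRel G.Adj] (x : V → ZMod 2) :
    IsChannel G (Function.support x) ↔ (G.adjMatrix (ZMod 2)).mulVec x = 0 := by
  classical
  rw [funext_iff]
  refine forall_congr' fun v => ?_
  have hx (w : V) : x w = if x w ≠ 0 then 1 else 0 := by
    generalize x w = a
    revert a
    decide
  rw [SimpleGraph.adjMatrix_mulVec_apply, Finset.sum_congr rfl fun w _ => hx w,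
    ← Finset.natCast_card_filter, Pi.zero_apply, ZMod.natCast_eq_zero_iff_even,
    ← Set.ncard_coe_finset]
  congr! 3
  ext w
  simp [and_comm]

/-- Lovász: `m_G` is even iff `G` has a nonempty channel. -/
theorem even_matchCount_iff_exists_channel {V : Type*} [Fintype V] (G : SimpleGraph V) :
    Even (matchCount G) ↔ ∃ C : Set V, C.Nonempty ∧ IsChannel G C := by
  classical
  rw [← ZMod.natCast_eq_zero_iff_even, matchCount_cast_eq_det_adjMatrix,
    ← Matrix.exists_mulVec_eq_zero_iff]
  constructor
  · rintro ⟨x, hx, h⟩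
    exact ⟨Function.support x, Function.support_nonempty_iff.2 hx,
      (isChannel_iff_adjMatrix_mulVec_eq_zero G x).2 h⟩
  · rintro ⟨C, hC, h⟩
    have hsupp : Function.support (C.indicator (1 : V → ZMod 2)) = C := by
      simp [Function.support_one]
    refine ⟨C.indicator 1, ?_, ?_⟩
    · rwa [← Function.support_nonempty_iff, hsupp]
    · rwa [← isChannel_iff_adjMatrix_mulVec_eq_zero, hsupp]
end

section
/- Let G be a finite simple graph with adjacency matrix A (the ℤ-matrix indexed by vertices with A v w = 1 if v and w are adjacent and 0 otherwise). Then the number of perfect matchings of G is congruent modulo 2 to the determinant of the reduction of A modulo 2; that is, in ℤ/2ℤ one has m_G = det A₂, where A₂ is A with entries reduced mod 2. -/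
/-- Perfect matchings of `G` correspond to involutions of the vertices sending each vertex to one
of its neighbours. -/
noncomputable def perfectMatchingEquivInvolution {V : Type*} (G : SimpleGraph V) :
    {M : G.Subgraph // M.IsPerfectMatching} ≃
      {σ : Equiv.Perm V // (∀ v, G.Adj (σ v) v) ∧ σ⁻¹ = σ} where
  toFun M :=
    have h := SimpleGraph.Subgraph.isPerfectMatching_iff.1 M.2
    have hadj v : M.1.Adj v (h v).choose := (h v).choose_spec.1
    have hinv : Function.Involutive fun v ↦ (h v).choose := fun v ↦
      (h _).unique (hadj _) (hadj v).symm
    ⟨hinv.toPerm _, fun v ↦ (hadj v).adj_sub.symm, rfl⟩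
  invFun σ :=
    have hinv v : σ.1 (σ.1 v) = v :=
      (Equiv.Perm.inv_eq_iff_eq.1 (DFunLike.congr_fun σ.2.2 v)).symm
    ⟨{  verts := Set.univ
        Adj := fun v w ↦ σ.1 v = w
        adj_sub := by rintro v _ rfl; exact (σ.2.1 v).symm
        edge_vert := fun _ ↦ Set.mem_univ _
        symm := ⟨by rintro v _ rfl; exact hinv v⟩ },
      SimpleGraph.Subgraph.isPerfectMatching_iff.2 fun v ↦ ⟨σ.1 v, rfl, fun _ h ↦ Eq.symm h⟩⟩
  left_inv M := by
    have h := SimpleGraph.Subgraph.isPerfectMatching_iff.1 M.2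
    ext v w
    · simpa using M.2.2 v
    · change (h v).choose = w ↔ M.1.Adj v w
      exact ⟨fun e ↦ e ▸ (h v).choose_spec.1, fun hw ↦ (h v).unique (h v).choose_spec.1 hw⟩
  right_inv σ := by
    ext v
    have h : ∃! w, σ.1 v = w := ⟨σ.1 v, rfl, fun _ h ↦ h.symm⟩
    exact h.choose_spec.1.symm

/-- Over `ZMod 2`, the determinant of the adjacency matrix counts the permutations sending each
vertex to one of its neighbours. -/
theorem det_adjMatrix_zmod_two {V : Type*} [Fintype V] [DecidableEq V]
    (G : SimpleGraph V) [DecidableRel G.Adj] :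
    (G.adjMatrix (ZMod 2)).det =
      ∑ σ : Equiv.Perm V, if ∀ v, G.Adj (σ v) v then 1 else 0 := by
  rw [Matrix.det_apply']
  refine Finset.sum_congr rfl fun σ _ ↦ ?_
  have hsign : ((Equiv.Perm.sign σ : ℤ) : ZMod 2) = 1 := by
    rcases Int.units_eq_one_or (Equiv.Perm.sign σ) with h | h <;> rw [h] <;> decide
  rw [hsign, one_mul]
  simp [SimpleGraph.adjMatrix_apply, Finset.prod_ite_zero]

/-- The number of perfect matchings of `G` is congruent mod 2 to the determinant of the
adjacency matrix of `G` reduced modulo 2. -/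
theorem matchCount_eq_det_adjMatrix_mod_two {V : Type*} [Fintype V] [DecidableEq V]
    (G : SimpleGraph V) [DecidableRel G.Adj] :
    ((matchCount G : ZMod 2)) =
      ((G.adjMatrix ℤ).map (Int.cast : ℤ → ZMod 2)).det := by
  have hmap : (G.adjMatrix ℤ).map (Int.cast : ℤ → ZMod 2) = G.adjMatrix (ZMod 2) := by
    ext v w
    simp [SimpleGraph.adjMatrix_apply, apply_ite (Int.cast : ℤ → ZMod 2)]
  have hinv (σ : Equiv.Perm V) : (∀ v, G.Adj (σ⁻¹ v) v) ↔ ∀ v, G.Adj (σ v) v :=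
    ⟨fun h v ↦ by simpa using (h (σ v)).symm, fun h v ↦ by simpa using (h (σ⁻¹ v)).symm⟩
  have hcancel : ∑ σ : Equiv.Perm V with ¬ σ⁻¹ = σ,
      (if ∀ v, G.Adj (σ v) v then 1 else 0 : ZMod 2) = 0 := by
    refine Finset.sum_involution (fun σ _ ↦ σ⁻¹) (fun σ _ ↦ ?_) (fun σ hσ _ ↦ ?_)
      (fun σ hσ ↦ ?_) (fun σ _ ↦ inv_inv σ)
    · simp only [hinv]
      exact CharTwo.add_self_eq_zero _
    · simpa using hσ
    · simpa [eq_comm] using hσ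
  rw [hmap, det_adjMatrix_zmod_two, ← Finset.sum_filter_add_sum_filter_not _ (fun σ ↦ σ⁻¹ = σ),
    hcancel, add_zero, Finset.sum_boole, Finset.filter_filter, matchCount,
    Nat.card_congr (perfectMatchingEquivInvolution G), Nat.card_eq_fintype_card,
    Fintype.card_subtype]
  simp only [and_comm]
end

section
/- Let A be a square matrix with integer entries. Then 2^{nul₂ A} divides det A, where nul₂ A is the dimension over ℤ/2ℤ of the kernel of the reduction of A modulo 2. -/
/-- The 2-nullity of an integer matrix: the dimension over `ℤ/2ℤ` of the kernel of its
reduction modulo 2 (viewed as a linear map on column vectors). -/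
noncomputable def nulTwo {m n : Type*} [Fintype m] [Fintype n] (A : Matrix m n ℤ) : ℕ :=
  Module.finrank (ZMod 2)
    (LinearMap.ker (Matrix.mulVecLin (A.map (Int.cast : ℤ → ZMod 2))))

/-- If every column of `A` indexed by `s` is divisible by `d`, then `d ^ #s` divides `det A`. -/
theorem Matrix.pow_card_dvd_det {n R : Type*} [Fintype n] [DecidableEq n] [CommRing R]
    (A : Matrix n n R) (d : R) (s : Finset n) (h : ∀ j ∈ s, ∀ i, d ∣ A i j) :
    d ^ s.card ∣ A.det := by
  rw [Matrix.det_apply]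
  refine Finset.dvd_sum fun σ _ => ?_
  rw [Units.smul_def, zsmul_eq_mul]
  refine Dvd.dvd.mul_left ?_ _
  rw [← Finset.prod_const]
  exact (Finset.prod_dvd_prod_of_dvd _ _ fun j hj => h j hj (σ j)).trans
    (Finset.prod_dvd_prod_of_subset _ _ _ s.subset_univ)

/-- Over a field, the nullity of a square matrix is the number of zero entries of any diagonal
matrix equivalent to it. -/
theorem Matrix.finrank_ker_mulVecLin_of_mul_mul_eq_diagonal {n K : Type*} [Fintype n]
    [DecidableEq n] [Field K] [DecidableEq K] {P Q A : Matrix n n K} {D : n → K}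
    (hP : IsUnit P.det) (hQ : IsUnit Q.det) (h : P * A * Q = Matrix.diagonal D) :
    Module.finrank K (LinearMap.ker A.mulVecLin) = (Finset.univ.filter fun i => D i = 0).card := by
  have hrank : A.rank = (Finset.univ.filter fun i => D i ≠ 0).card := by
    rw [← Matrix.rank_mul_eq_right_of_isUnit_det P A hP,
      ← Matrix.rank_mul_eq_left_of_isUnit_det Q (P * A) hQ, h, Matrix.rank_diagonal,
      Fintype.card_subtype]
  have hnull := A.mulVecLin.finrank_range_add_finrank_ker
  have hcard := Finset.card_filter_add_card_filter_not (s := (Finset.univ : Finset n))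
    (fun i => D i = 0)
  rw [Module.finrank_fintype_fun_eq_card] at hnull
  rw [Finset.card_univ] at hcard
  change A.rank + _ = _ at hnull
  simp only [ne_eq] at hrank
  omega

/-- Every matrix over `ZMod p` with unit determinant lifts to an integer matrix whose determinant
is coprime to `p`. -/
theorem ZMod.exists_matrix_map_intCast_eq {n : Type*} [Fintype n] [DecidableEq n] {p : ℕ}
    {P : Matrix n n (ZMod p)} (hP : IsUnit P.det) :
    ∃ P' : Matrix n n ℤ, P'.map (Int.cast : ℤ → ZMod p) = P ∧ IsCoprime (p : ℤ) P'.det := by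
  choose f hf using ZMod.intCast_surjective (n := p)
  have hmap : (P.map f).map (Int.cast : ℤ → ZMod p) = P := by
    ext i j
    exact hf _
  refine ⟨P.map f, hmap, ?_⟩
  rw [← ZMod.coe_int_isUnit_iff_isCoprime, Int.cast_det]
  exact hmap.symm ▸ hP

/-- For a square integer matrix `A`, `2 ^ nul₂ A` divides `det A`. -/
theorem pow_two_nulTwo_dvd_det {n : Type*} [Fintype n] [DecidableEq n] (A : Matrix n n ℤ) :
    (2 : ℤ) ^ nulTwo A ∣ A.det := by
  obtain ⟨L, L', D, h⟩ := Matrix.Pivot.exists_list_transvec_mul_mul_list_transvec_eq_diagonal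
    (A.map (Int.cast : ℤ → ZMod 2))
  have hL : IsUnit (L.map Matrix.TransvectionStruct.toMatrix).prod.det := by simp
  have hL' : IsUnit (L'.map Matrix.TransvectionStruct.toMatrix).prod.det := by simp
  rw [nulTwo, Matrix.finrank_ker_mulVecLin_of_mul_mul_eq_diagonal hL hL' h]
  obtain ⟨P, hP, hPdet⟩ := ZMod.exists_matrix_map_intCast_eq hL
  obtain ⟨Q, hQ, hQdet⟩ := ZMod.exists_matrix_map_intCast_eq hL'
  rw [← hP, ← hQ] at h
  have hmap : (P * A * Q).map (Int.cast : ℤ → ZMod 2) = Matrix.diagonal D := by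
    rw [← h]
    simp only [← Int.coe_castRingHom, Matrix.map_mul]
  have hdvd := Matrix.pow_card_dvd_det (P * A * Q) 2 (Finset.univ.filter fun i => D i = 0)
    fun j hj i => by
      refine (ZMod.intCast_zmod_eq_zero_iff_dvd _ 2).mp ?_
      have hentry := congrFun (congrFun hmap i) j
      rw [Matrix.map_apply] at hentry
      rw [hentry, Matrix.diagonal_apply]
      split_ifs with hij
      · exact hij ▸ (Finset.mem_filter.mp hj).2
      · rfl
  rw [Matrix.det_mul, Matrix.det_mul] at hdvd
  exact hPdet.pow_left.dvd_of_dvd_mul_left (hQdet.pow_left.dvd_of_dvd_mul_right hdvd)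
end

section
/- Let G be a finite simple graph with adjacency matrix A, and suppose G admits a Kasteleyn signing: an integer matrix K indexed by the vertices of G such that for all vertices i, j either K i j = A i j or K i j = −(A i j), and det K = m_G². Then 2^{nul₂ A} divides m_G². -/
/-- If `d` is the nullity of an integer square matrix modulo a prime `p`, then `p ^ d` divides
its determinant. -/
theorem Matrix.pow_finrank_ker_map_intCast_dvd_det {n : Type*} [Fintype n] [DecidableEq n]
    (p : ℕ) [Fact p.Prime] (M : Matrix n n ℤ) :
    (p : ℤ) ^ Module.finrank (ZMod p)
      (LinearMap.ker (Matrix.mulVecLin (M.map (Int.cast : ℤ → ZMod p)))) ∣ M.det := by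
  set N := LinearMap.ker (Matrix.mulVecLin (M.map (Int.cast : ℤ → ZMod p))) with hN
  obtain ⟨C, hC⟩ := Submodule.exists_isCompl N
  -- a basis of `(ℤ/p)ⁿ` extending a basis of the kernel
  let b₀ := ((Module.finBasis (ZMod p) N).prod (Module.finBasis (ZMod p) C)).map
    (Submodule.prodEquivOfIsCompl N C hC)
  let e := b₀.indexEquiv (Pi.basisFun (ZMod p) n)
  let b := b₀.reindex e
  have hker : ∀ j, (e.symm j).isLeft → (M.map (Int.cast : ℤ → ZMod p)).mulVec (b j) = 0 := by
    intro j hj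
    obtain ⟨k, hk⟩ := Sum.isLeft_iff.1 hj
    have hmem : b j ∈ N := by simp [b, b₀, hk]
    simpa [hN] using hmem
  -- lift it to an integer matrix whose determinant is prime to `p`
  choose P hP using fun i j => ZMod.intCast_surjective (b j i)
  have hPmap : (Matrix.of P).map (Int.cast : ℤ → ZMod p)
      = (Pi.basisFun (ZMod p) n).toMatrix b := by
    ext i j
    simp [hP, Module.Basis.toMatrix_apply]
  have hdetP : IsCoprime (p : ℤ) (Matrix.of P).det := by
    rw [(Nat.prime_iff_prime_int.1 Fact.out).coprime_iff_not_dvd,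
      ← ZMod.intCast_zmod_eq_zero_iff_dvd, Int.cast_det]
    have h := congrArg Matrix.det
      (Module.Basis.toMatrix_mul_toMatrix_flip (Pi.basisFun (ZMod p) n) b)
    rw [Matrix.det_mul, Matrix.det_one, ← hPmap] at h
    exact left_ne_zero_of_mul_eq_one h
  -- the columns of `M * P` coming from the kernel are divisible by `p`
  let c : n → ℤ := fun j => if (e.symm j).isLeft then p else 1
  have hdvd : ∀ i j, c j ∣ (M * Matrix.of P) i j := by
    intro i j
    by_cases hj : (e.symm j).isLeft
    · simp only [c, hj, if_true]
      rw [← ZMod.intCast_zmod_eq_zero_iff_dvd]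
      simpa [Matrix.mul_apply, Matrix.mulVec, dotProduct, hP] using congrFun (hker j hj) i
    · simp [c, hj]
  choose Q hQ using hdvd
  have hfac : M * Matrix.of P = Matrix.of Q * Matrix.diagonal c := by
    ext i j
    rw [Matrix.mul_diagonal, hQ, mul_comm, Matrix.of_apply]
  have hc : ∏ j, c j = (p : ℤ) ^ Module.finrank (ZMod p) N := by
    rw [← e.prod_comp, Fintype.prod_sum_type]
    simp [c]
  refine hdetP.pow_left.dvd_of_dvd_mul_right ?_
  rw [← Matrix.det_mul, hfac, Matrix.det_mul, Matrix.det_diagonal, hc]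
  exact dvd_mul_left _ _

/-- If `G` admits a Kasteleyn signing `K` (entrywise `±` the adjacency matrix, with
`det K = m_G ^ 2`), then `2 ^ nul₂ A` divides `m_G ^ 2`. -/
theorem pow_two_nulTwo_adj_dvd_sq_matchCount {V : Type*} [Fintype V] [DecidableEq V]
    (G : SimpleGraph V) [DecidableRel G.Adj] (K : Matrix V V ℤ)
    (hsign : ∀ i j, K i j = G.adjMatrix ℤ i j ∨ K i j = -(G.adjMatrix ℤ i j))
    (hdet : K.det = (matchCount G : ℤ) ^ 2) :
    (2 : ℤ) ^ nulTwo (G.adjMatrix ℤ) ∣ (matchCount G : ℤ) ^ 2 := by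
  have hmap : (G.adjMatrix ℤ).map (Int.cast : ℤ → ZMod 2) = K.map Int.cast := by
    ext i j
    rcases hsign i j with h | h <;> simp only [Matrix.map_apply, h, Int.cast_neg, CharTwo.neg_eq]
  rw [← hdet, nulTwo, hmap]
  exact_mod_cast K.pow_finrank_ker_map_intCast_dvd_det 2
end

section
/- Let G be a finite bipartite simple graph with a fixed proper 2-coloring of its vertices into black and white, with equally many black and white vertices, and let B be its bipartite adjacency matrix (rows indexed by white vertices, columns by black vertices, with entry 1 exactly when the two vertices are adjacent). Suppose there exists an integer matrix H with H i j = ±(B i j) entrywise such that det H = m_G. Then 2^{nul₂ B} divides m_G. -/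
/-- If the columns of `A` indexed by `s` are divisible by `a`, then `a ^ #s` divides `det A`. -/
theorem Matrix.pow_card_dvd_det_of_dvd_columns {n R : Type*} [Fintype n] [DecidableEq n]
    [CommRing R] (A : Matrix n n R) (a : R) (s : Finset n)
    (h : ∀ j ∈ s, ∀ i, a ∣ A i j) : a ^ s.card ∣ A.det := by
  have hfactor : ∀ i j, ∃ c, A i j = (if j ∈ s then a else 1) * c := by
    intro i j
    split_ifs with hj
    · exact h j hj i
    · exact ⟨A i j, (one_mul _).symm⟩
  choose C hC using hfactor
  have hA : A = Matrix.of fun i j => (if j ∈ s then a else 1) * Matrix.of C i j := by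
    ext i j
    exact hC i j
  rw [hA, Matrix.det_mul_row]
  simp

/-- A subspace `W` of `n → K` contains `finrank W` members of some basis indexed by `n`. -/
theorem Submodule.exists_basis_finset_mem {n K : Type*} [Fintype n] [Field K]
    (W : Submodule K (n → K)) :
    ∃ (b : Module.Basis n K (n → K)) (s : Finset n),
      s.card = Module.finrank K W ∧ ∀ j ∈ s, b j ∈ W := by
  obtain ⟨U, hU⟩ := W.exists_isCompl
  let c := ((Module.finBasis K W).prod (Module.finBasis K U)).map
    (W.prodEquivOfIsCompl U hU)
  let e := c.indexEquiv (Pi.basisFun K n)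
  refine ⟨c.reindex e, Finset.univ.map (Function.Embedding.inl.trans e.toEmbedding), ?_, ?_⟩
  · simp
  · intro j hj
    obtain ⟨i, -, rfl⟩ := Finset.mem_map.mp hj
    simp [c]

/-- A prime raised to the nullity modulo `p` of an integer matrix divides its determinant. -/
theorem Matrix.prime_pow_finrank_ker_dvd_det {n : Type*} [Fintype n] [DecidableEq n]
    (p : ℕ) [Fact p.Prime] (A : Matrix n n ℤ) :
    (p : ℤ) ^ Module.finrank (ZMod p)
      (LinearMap.ker (A.map (Int.cast : ℤ → ZMod p)).mulVecLin) ∣ A.det := by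
  obtain ⟨b, s, hs, hb⟩ := Submodule.exists_basis_finset_mem
    (LinearMap.ker (A.map (Int.cast : ℤ → ZMod p)).mulVecLin)
  choose lift hlift using ZMod.intCast_surjective (n := p)
  let P : Matrix n n ℤ := Matrix.of fun i j => lift (b j i)
  have hP : P.map (Int.cast : ℤ → ZMod p) = (Pi.basisFun (ZMod p) n).toMatrix b := by
    ext i j
    simp [P, hlift, Module.Basis.toMatrix_apply]
  have hdetP : ¬ (p : ℤ) ∣ P.det := by
    rw [← ZMod.intCast_zmod_eq_zero_iff_dvd, Int.cast_det, hP]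
    exact ((Pi.basisFun (ZMod p) n).isUnit_det b).ne_zero
  have hcop : IsCoprime ((p : ℤ) ^ s.card) P.det :=
    (((Nat.prime_iff_prime_int.mp Fact.out).coprime_iff_not_dvd).mpr hdetP).pow_left
  rw [← hs]
  refine hcop.dvd_of_dvd_mul_right ?_
  rw [← Matrix.det_mul]
  refine Matrix.pow_card_dvd_det_of_dvd_columns _ _ s fun j hj i => ?_
  have hker := congrFun (LinearMap.mem_ker.mp (hb j hj)) i
  rw [← ZMod.intCast_zmod_eq_zero_iff_dvd, Matrix.mul_apply]
  simpa [P, hlift, Matrix.mulVec, dotProduct] using hker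

/-- Rank-nullity for the reduction modulo 2 of an integer matrix. -/
theorem rank_add_nulTwo {m n : Type*} [Fintype m] [Fintype n] (A : Matrix m n ℤ) :
    (A.map (Int.cast : ℤ → ZMod 2)).rank + nulTwo A = Fintype.card n :=
  (LinearMap.finrank_range_add_finrank_ker _).trans (Module.finrank_fintype_fun_eq_card _)

/-- Reindexing the columns of an integer matrix does not change its 2-nullity. -/
theorem nulTwo_submatrix_equiv {m n o : Type*} [Fintype m] [Fintype n] [Fintype o]
    (A : Matrix m n ℤ) (e : o ≃ n) : nulTwo (A.submatrix id e) = nulTwo A := by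
  have hrank : ((A.submatrix id e).map (Int.cast : ℤ → ZMod 2)).rank =
      (A.map (Int.cast : ℤ → ZMod 2)).rank :=
    Matrix.rank_submatrix (A.map (Int.cast : ℤ → ZMod 2)) (Equiv.refl m) e
  have hA := rank_add_nulTwo A
  have hAe := rank_add_nulTwo (A.submatrix id e)
  rw [hrank, Fintype.card_congr e] at hAe
  lia

/-- Changing signs of entries does not change the 2-nullity. -/
theorem nulTwo_eq_of_eq_or_eq_neg {m n : Type*} [Fintype m] [Fintype n] {A B : Matrix m n ℤ}
    (h : ∀ i j, A i j = B i j ∨ A i j = -B i j) : nulTwo A = nulTwo B := by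
  have hmap : A.map (Int.cast : ℤ → ZMod 2) = B.map (Int.cast : ℤ → ZMod 2) := by
    ext i j
    rcases h i j with hij | hij <;> simp [hij]
  rw [nulTwo, nulTwo, hmap]

/-- Bipartite version: if the bipartite adjacency matrix `B` (rows indexed by white
vertices, columns by black ones) admits a signing `H` with `det H = m_G`, then
`2 ^ nul₂ B` divides `m_G`. -/
theorem pow_two_nulTwo_bipartite_dvd_matchCount {V : Type*} [Fintype V] [DecidableEq V]
    (G : SimpleGraph V) [DecidableRel G.Adj] (color : V → Bool)
    (hcol : ∀ ⦃v w : V⦄, G.Adj v w → color v ≠ color w)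
    (hcard : Fintype.card {v : V // color v = true} = Fintype.card {v : V // color v = false})
    (e : {v : V // color v = false} ≃ {v : V // color v = true})
    (B : Matrix {v : V // color v = false} {v : V // color v = true} ℤ)
    (hB : ∀ i j, B i j = if G.Adj i.val j.val then 1 else 0)
    (H : Matrix {v : V // color v = false} {v : V // color v = true} ℤ)
    (hsign : ∀ i j, H i j = B i j ∨ H i j = -(B i j))
    (hdet : (H.submatrix id e).det = (matchCount G : ℤ)) :
    (2 : ℤ) ^ nulTwo B ∣ (matchCount G : ℤ) := by
  rw [← hdet, ← nulTwo_eq_of_eq_or_eq_neg hsign, ← nulTwo_submatrix_equiv H e]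
  exact Matrix.prime_pow_finrank_ker_dvd_det 2 (H.submatrix id e)
end

section
/- Let G be a finite bipartite simple graph with a fixed proper 2-coloring of its vertices into black and white. Then a set C of vertices of G is a channel if and only if both the set of black vertices of C and the set of white vertices of C are channels. Consequently, the number of channels of G equals the product of the number of channels consisting only of black vertices and the number of channels consisting only of white vertices. -/
/-- The part of `C` of color `b` is a channel iff every vertex not of color `b` has an even number
of neighbors in `C`. -/
theorem isChannel_sep_color_iff {V : Type*} {G : SimpleGraph V} {color : V → Bool}
    (hcol : ∀ ⦃v w : V⦄, G.Adj v w → color v ≠ color w) (C : Set V) (b : Bool) :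
    IsChannel G {v ∈ C | color v = b} ↔
      ∀ v, color v ≠ b → Even {w | w ∈ C ∧ G.Adj v w}.ncard := by
  refine forall_congr' fun v => ?_
  by_cases hv : color v = b
  · have h : {w | w ∈ {v ∈ C | color v = b} ∧ G.Adj v w} = ∅ :=
      Set.eq_empty_of_forall_notMem fun w hw => hcol hw.2 (hv.trans hw.1.2.symm)
    rw [h]
    simp [hv]
  · have h : {w | w ∈ {v ∈ C | color v = b} ∧ G.Adj v w} = {w | w ∈ C ∧ G.Adj v w} := by
      refine Set.ext fun w => ⟨fun hw => ⟨hw.1.1, hw.2⟩, fun hw => ⟨⟨hw.1, ?_⟩, hw.2⟩⟩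
      rw [Bool.eq_not_of_ne (hcol hw.2).symm, Bool.eq_not_of_ne hv, Bool.not_not]
    rw [h]
    simp [hv]

/-- A set is a channel iff its two color classes are. -/
theorem isChannel_iff_sep_color {V : Type*} {G : SimpleGraph V} {color : V → Bool}
    (hcol : ∀ ⦃v w : V⦄, G.Adj v w → color v ≠ color w) (C : Set V) :
    IsChannel G C ↔
      IsChannel G {v ∈ C | color v = true} ∧ IsChannel G {v ∈ C | color v = false} := by
  rw [isChannel_sep_color_iff hcol, isChannel_sep_color_iff hcol, ← forall_and]
  refine forall_congr' fun v => ?_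
  cases color v <;> simp

/-- Splitting a channel into its two color classes. -/
def channelEquivProd {V : Type*} {G : SimpleGraph V} {color : V → Bool}
    (hcol : ∀ ⦃v w : V⦄, G.Adj v w → color v ≠ color w) :
    {C : Set V // IsChannel G C} ≃
      {C : Set V // IsChannel G C ∧ ∀ v ∈ C, color v = true} ×
        {C : Set V // IsChannel G C ∧ ∀ v ∈ C, color v = false} where
  toFun C :=
    (⟨{v ∈ C.1 | color v = true}, ((isChannel_iff_sep_color hcol _).1 C.2).1, fun _ h => h.2⟩,
      ⟨{v ∈ C.1 | color v = false}, ((isChannel_iff_sep_color hcol _).1 C.2).2, fun _ h => h.2⟩)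
  invFun P := ⟨P.1.1 ∪ P.2.1, by
    obtain ⟨⟨B, hB, hBc⟩, ⟨W, hW, hWc⟩⟩ := P
    have h₁ : {v ∈ B ∪ W | color v = true} = B := by ext v; grind
    have h₂ : {v ∈ B ∪ W | color v = false} = W := by ext v; grind
    rw [isChannel_iff_sep_color hcol, h₁, h₂]
    exact ⟨hB, hW⟩⟩
  left_inv C := by
    ext v
    cases h : color v <;> simp [h]
  right_inv P := by
    obtain ⟨⟨B, hB, hBc⟩, ⟨W, hW, hWc⟩⟩ := P
    ext v <;> grind

/-- In a bipartite graph, a set is a channel iff its black part and its white part are both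
channels; hence the number of channels is the product of the number of black channels and
the number of white channels. -/
theorem isChannel_iff_black_and_white {V : Type*} [Fintype V] (G : SimpleGraph V)
    (color : V → Bool) (hcol : ∀ ⦃v w : V⦄, G.Adj v w → color v ≠ color w) :
    (∀ C : Set V, IsChannel G C ↔
        (IsChannel G {v ∈ C | color v = true} ∧ IsChannel G {v ∈ C | color v = false})) ∧
    Nat.card {C : Set V // IsChannel G C} =
      Nat.card {C : Set V // IsChannel G C ∧ ∀ v ∈ C, color v = true} *
        Nat.card {C : Set V // IsChannel G C ∧ ∀ v ∈ C, color v = false} := by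
  exact ⟨isChannel_iff_sep_color hcol,
    (Nat.card_congr (channelEquivProd hcol)).trans (Nat.card_prod _ _)⟩
end

section
/- Let G be a finite simple graph with adjacency matrix A admitting a Kasteleyn signing, i.e., an integer matrix K with K i j = ±(A i j) entrywise and det K = m_G². If C₁, …, Cₙ are channels of G whose indicator vectors over ℤ/2ℤ are linearly independent, then 2ⁿ divides m_G². -/
/-- If the reduction modulo a prime `p` of an integer matrix `M` has `n` linearly independent
vectors in its kernel, then `p ^ n` divides `M.det`. -/
theorem Matrix.prime_pow_dvd_det_of_linearIndependent_ker {V : Type*} [Fintype V] [DecidableEq V]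
    {p : ℕ} [hp : Fact p.Prime] (M : Matrix V V ℤ) {n : ℕ} {v : Fin n → V → ZMod p}
    (hli : LinearIndependent (ZMod p) v)
    (hker : ∀ i, (M.map (Int.cast : ℤ → ZMod p)).mulVec (v i) = 0) :
    (p : ℤ) ^ n ∣ M.det := by
  classical
  let b₀ := Module.Basis.sumExtend hli
  let e := b₀.indexEquiv (Pi.basisFun (ZMod p) V)
  let b := b₀.reindex e
  have hb : ∀ i, b (e (Sum.inl i)) = v i := fun i => by
    simp only [b, b₀, Module.Basis.sumExtend, Module.Basis.reindex_apply, Equiv.symm_apply_apply,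
      Module.Basis.extend_apply_self]
    rfl
  choose lift hlift using ZMod.intCast_surjective (n := p)
  let B : Matrix V V ℤ := Matrix.of fun i j => lift (b j i)
  have hBmap : B.map (Int.cast : ℤ → ZMod p) = (Pi.basisFun (ZMod p) V).toMatrix b := by
    ext i j
    simp [B, hlift, Module.Basis.toMatrix_apply]
  have hBdet : ¬ (p : ℤ) ∣ B.det := by
    rw [← ZMod.intCast_zmod_eq_zero_iff_dvd, Int.cast_det, hBmap]
    exact ((Pi.basisFun (ZMod p) V).isUnit_det b).ne_zero
  let S : Finset V := Finset.univ.image fun i : Fin n => e (Sum.inl i)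
  have hS : S.card = n := by
    rw [Finset.card_image_of_injective (f := fun i => e (Sum.inl i)) _
      (e.injective.comp Sum.inl_injective)]
    simp
  let d : V → ℤ := fun j => if j ∈ S then p else 1
  have hcol : ∀ i j, d j ∣ (M * B) i j := by
    intro i j
    by_cases hj : j ∈ S
    · obtain ⟨k, -, rfl⟩ := Finset.mem_image.mp hj
      simp only [d, if_pos hj]
      rw [← ZMod.intCast_zmod_eq_zero_iff_dvd]
      simpa [Matrix.mul_apply, Matrix.mulVec, dotProduct, B, hlift, hb]
        using congrFun (hker k) i
    · simp [d, hj]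
  choose N hN using hcol
  have hfac : M * B = Matrix.of N * Matrix.diagonal d := by
    ext i j
    rw [Matrix.mul_diagonal, hN, Matrix.of_apply, mul_comm]
  have hdvd : (p : ℤ) ^ n ∣ M.det * B.det := by
    rw [← Matrix.det_mul, hfac, Matrix.det_mul, Matrix.det_diagonal]
    refine Dvd.dvd.mul_left (dvd_of_eq ?_) _
    simp [d, hS]
  have hprime : Prime (p : ℤ) := Nat.prime_iff_prime_int.mp hp.out
  exact hprime.pow_dvd_of_dvd_mul_right n hBdet hdvd

/-- The indicator vector of a channel lies in the kernel of the adjacency matrix modulo `2`. -/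
theorem IsChannel.adjMatrix_mulVec_indicator {V : Type*} [Fintype V] {G : SimpleGraph V}
    [DecidableRel G.Adj] {C : Set V} (hC : IsChannel G C) :
    (G.adjMatrix (ZMod 2)).mulVec (C.indicator fun _ => 1) = 0 := by
  classical
  ext v
  have h := (ZMod.natCast_eq_zero_iff_even).mpr (hC v)
  rw [Set.ncard_eq_toFinset_card', Set.toFinset_ofPred, ← Finset.sum_boole] at h
  rw [Pi.zero_apply, ← h, Matrix.mulVec, dotProduct]
  refine Finset.sum_congr rfl fun w _ => ?_
  by_cases hw : w ∈ C <;> simp [hw]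

/-- Channeling 2s: if `G` admits a Kasteleyn signing and `C₁, …, Cₙ` are channels with
linearly independent `ℤ/2ℤ` indicator vectors, then `2ⁿ` divides `m_G²`. -/
theorem channeling_twos {V : Type*} [Fintype V] [DecidableEq V]
    (G : SimpleGraph V) [DecidableRel G.Adj] (K : Matrix V V ℤ)
    (hsign : ∀ i j, K i j = G.adjMatrix ℤ i j ∨ K i j = -(G.adjMatrix ℤ i j))
    (hdet : K.det = (matchCount G : ℤ) ^ 2)
    (n : ℕ) (C : Fin n → Set V) (hch : ∀ i, IsChannel G (C i))
    (hli : LinearIndependent (ZMod 2)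
      (fun i : Fin n => (C i).indicator (fun _ => (1 : ZMod 2)))) :
    (2 : ℤ) ^ n ∣ (matchCount G : ℤ) ^ 2 := by
  have hK : K.map (Int.cast : ℤ → ZMod 2) = G.adjMatrix (ZMod 2) := by
    ext i j
    rcases hsign i j with h | h <;> by_cases hij : G.Adj i j <;> simp [h, hij]
  rw [← hdet]
  refine K.prime_pow_dvd_det_of_linearIndependent_ker (p := 2) hli fun i => ?_
  rw [hK]
  exact (hch i).adjMatrix_mulVec_indicator
end

section
/- Let G be a finite bipartite simple graph with a fixed proper 2-coloring into black and white vertices, with equally many black and white vertices, and with bipartite adjacency matrix B (rows indexed by white vertices, columns by black vertices). Suppose there exists an integer matrix H with H i j = ±(B i j) entrywise and det H = m_G. If C₁, …, Cₙ are channels of G consisting only of black vertices whose indicator vectors over ℤ/2ℤ are linearly independent, then 2ⁿ divides m_G. -/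
theorem Module.Basis.sumExtend_inl {ι K V : Type*} [DivisionRing K] [AddCommGroup V] [Module K V]
    {v : ι → V} (hv : LinearIndependent K v) (i : ι) :
    Module.Basis.sumExtend hv (Sum.inl i) = v i := by
  rw [Module.Basis.sumExtend, Module.Basis.reindex_apply, Module.Basis.extend_apply_self]
  rfl

/-- If the reduction mod `2` of a square integer matrix kills `n` linearly independent vectors,
then `2 ^ n` divides its determinant. -/
theorem two_pow_dvd_det_of_linearIndependent_ker {m : Type*} [Fintype m] [DecidableEq m]
    (A : Matrix m m ℤ) {n : ℕ} (c : Fin n → m → ZMod 2) (hc : LinearIndependent (ZMod 2) c)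
    (hA : ∀ i v, ∑ w, ((A v w : ℤ) : ZMod 2) * c i w = 0) :
    (2 : ℤ) ^ n ∣ A.det := by
  classical
  let b := Module.Basis.sumExtend hc
  let σ := b.indexEquiv (Pi.basisFun (ZMod 2) m)
  have : Finite (Module.Basis.sumExtendIndex hc) :=
    Finite.of_injective (fun x => σ (Sum.inr x)) (σ.injective.comp Sum.inr_injective)
  have := Fintype.ofFinite (Module.Basis.sumExtendIndex hc)
  let P : Matrix m m ℤ := fun i j => ((b (σ.symm j) i).val : ℤ)
  have hPcast : ∀ i j, ((P i j : ℤ) : ZMod 2) = b (σ.symm j) i := fun i j => by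
    simp [P]
  have hPdet : ¬ (2 : ℤ) ∣ P.det := by
    intro h
    have h0 : ((P.det : ℤ) : ZMod 2) = 0 := (ZMod.intCast_zmod_eq_zero_iff_dvd _ 2).2 h
    have hli : LinearIndependent (ZMod 2) (P.map (Int.castRingHom (ZMod 2))).col := by
      have : (P.map (Int.castRingHom (ZMod 2))).col = fun j => b (σ.symm j) := by
        ext j i
        exact hPcast i j
      rw [this]
      exact b.linearIndependent.comp _ σ.symm.injective
    have hu := (Matrix.isUnit_iff_isUnit_det _).1 (Matrix.linearIndependent_cols_iff_isUnit.1 hli)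
    have hdet := (Int.castRingHom (ZMod 2)).map_det P
    rw [RingHom.mapMatrix_apply] at hdet
    rw [← hdet] at hu
    exact hu.ne_zero h0
  let d : m → ℤ := fun j => Sum.elim (fun _ => 2) (fun _ => 1) (σ.symm j)
  have hd : ∀ i j, d j ∣ (A * P) i j := by
    intro i j
    rcases hj : σ.symm j with k | k
    · have hdj : d j = 2 := by simp [d, hj]
      rw [hdj]
      refine (ZMod.intCast_zmod_eq_zero_iff_dvd _ 2).1 ?_
      rw [Matrix.mul_apply, Int.cast_sum, ← hA k i]
      refine Finset.sum_congr rfl fun w _ => ?_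
      rw [Int.cast_mul, hPcast, hj, Module.Basis.sumExtend_inl hc]
    · have hdj : d j = 1 := by simp [d, hj]
      rw [hdj]
      exact one_dvd _
  choose Q hQ using hd
  have hfac : A * P = Matrix.of Q * Matrix.diagonal d := by
    ext i j
    rw [Matrix.mul_diagonal, hQ, Matrix.of_apply, mul_comm]
  have hprod : ∏ j, d j = 2 ^ n := by
    rw [← σ.prod_comp]
    simp [d]
  have hdvd : (2 : ℤ) ^ n ∣ P.det * A.det := by
    rw [mul_comm, ← Matrix.det_mul, hfac, Matrix.det_mul, Matrix.det_diagonal, hprod]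
    exact dvd_mul_left _ _
  refine IsCoprime.dvd_of_dvd_mul_left ?_ hdvd
  exact ((Int.prime_two.coprime_iff_not_dvd).2 hPdet).pow_left

/-- Channeling 2s, bipartite version: if the bipartite adjacency matrix admits a signing
`H` with `det H = m_G`, and `C₁, …, Cₙ` are channels on black vertices with linearly
independent indicator vectors, then `2ⁿ` divides `m_G`. -/
theorem channeling_twos_bipartite {V : Type*} [Fintype V] [DecidableEq V]
    (G : SimpleGraph V) [DecidableRel G.Adj] (color : V → Bool)
    (hcol : ∀ ⦃v w : V⦄, G.Adj v w → color v ≠ color w)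
    (hcard : Fintype.card {v : V // color v = true} = Fintype.card {v : V // color v = false})
    (e : {v : V // color v = false} ≃ {v : V // color v = true})
    (B : Matrix {v : V // color v = false} {v : V // color v = true} ℤ)
    (hB : ∀ i j, B i j = if G.Adj i.val j.val then 1 else 0)
    (H : Matrix {v : V // color v = false} {v : V // color v = true} ℤ)
    (hsign : ∀ i j, H i j = B i j ∨ H i j = -(B i j))
    (hdet : (H.submatrix id e).det = (matchCount G : ℤ))
    (n : ℕ) (C : Fin n → Set V)
    (hch : ∀ i, IsChannel G (C i) ∧ ∀ v ∈ C i, color v = true)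
    (hli : LinearIndependent (ZMod 2)
      (fun i : Fin n => (C i).indicator (fun _ => (1 : ZMod 2)))) :
    (2 : ℤ) ^ n ∣ (matchCount G : ℤ) := by
  classical
  rw [← hdet]
  refine two_pow_dvd_det_of_linearIndependent_ker _
    (fun i w => (C i).indicator (fun _ => (1 : ZMod 2)) (e w).val) ?_ ?_
  · rw [Fintype.linearIndependent_iff] at hli ⊢
    intro g hg
    refine hli g (funext fun v => ?_)
    cases hv : color v with
    | true => simpa using congrFun hg (e.symm ⟨v, hv⟩)
    | false =>
      have hnot : ∀ i, v ∉ C i := fun i hi => by simp [(hch i).2 v hi] at hv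
      simp [hnot]
  · intro i v
    have hH : ∀ j, ((H v j : ℤ) : ZMod 2) = if G.Adj v.val j.val then 1 else 0 := by
      intro j
      rcases hsign v j with h | h <;> rw [h, hB] <;> split_ifs <;> simp
    simp only [Matrix.submatrix_apply, id, hH]
    rw [e.sum_comp (fun j => (if G.Adj v.val j.val then (1 : ZMod 2) else 0) *
      (C i).indicator (fun _ => (1 : ZMod 2)) j.val)]
    have hcount : ((Set.ncard {w | w ∈ C i ∧ G.Adj v.val w} : ℕ) : ZMod 2) = 0 :=
      (ZMod.natCast_eq_zero_iff_even).2 ((hch i).1 v.val)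
    refine Eq.trans ?_ hcount
    rw [Set.ncard_eq_toFinset_card', Set.toFinset_ofPred, Finset.card_filter,
      Nat.cast_sum, ← Fintype.sum_subtype_add_sum_subtype (fun w => color w = true),
      Fintype.sum_eq_zero (fun w : {w // ¬ color w = true} => _), add_zero]
    · refine Finset.sum_congr rfl fun j _ => ?_
      by_cases h : j.val ∈ C i <;> simp [h]
    · intro w
      have hw : w.val ∉ C i := fun h => w.2 ((hch i).2 w.val h)
      simp [hw]
end

section
/- Let r ≥ 1 and let D be the set of r horizontal edges of the grid graph R_{2r×2r} joining vertex (x, x) to vertex (x+1, x) for x = 0, 1, …, r−1. If G is the graph obtained from R_{2r×2r} by deleting any k distinct edges belonging to D (where 0 ≤ k ≤ r), then 2^{r−k} divides the number of perfect matchings of G. -/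
/-- The grid graph `R_{m×n}` on `{0,…,m−1} × {0,…,n−1}`: two vertices are adjacent iff
they differ by exactly 1 in exactly one coordinate. -/
def gridGraph (m n : ℕ) : SimpleGraph (Fin m × Fin n) :=
  SimpleGraph.fromRel (fun v w =>
    (v.1 = w.1 ∧ (v.2 : ℕ) + 1 = (w.2 : ℕ)) ∨ (v.2 = w.2 ∧ (v.1 : ℕ) + 1 = (w.1 : ℕ)))

open Function

/-- If `τ i`, for `i ∈ L`, are involutions of `X` each of which toggles the predicate `P i` and
preserves the predicates `P j` with `j ≠ i`, then `2 ^ #L` divides `#X`. -/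
theorem two_pow_card_dvd_of_toggle {α ι : Type*} (P : ι → α → Prop) (τ : ι → α → α)
    (L : Finset ι) (X : Finset α)
    (hX : ∀ i ∈ L, ∀ x ∈ X, τ i x ∈ X)
    (hinv : ∀ i ∈ L, ∀ x ∈ X, τ i (τ i x) = x)
    (htoggle : ∀ i ∈ L, ∀ x ∈ X, (P i (τ i x) ↔ ¬ P i x))
    (hkeep : ∀ i ∈ L, ∀ j ∈ L, j ≠ i → ∀ x ∈ X, (P j (τ i x) ↔ P j x)) :
    2 ^ L.card ∣ X.card := by
  classical
  induction L using Finset.induction_on generalizing X with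
  | empty => simp
  | insert i L hi ih =>
    have hcard : (X.filter (P i)).card = (X.filter (fun x => ¬ P i x)).card := by
      refine Finset.card_bij' (fun x _ => τ i x) (fun x _ => τ i x) ?_ ?_ ?_ ?_ <;>
        intro x hx <;> rw [Finset.mem_filter] at hx
      · simpa [hX i (by simp) x hx.1, htoggle i (by simp) x hx.1] using hx.2
      · simpa [hX i (by simp) x hx.1, htoggle i (by simp) x hx.1] using hx.2
      · exact hinv i (by simp) x hx.1
      · exact hinv i (by simp) x hx.1
    have hdvd : 2 ^ L.card ∣ (X.filter (P i)).card := by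
      apply ih
      · intro j hj x hx
        rw [Finset.mem_filter] at hx ⊢
        have hij : i ≠ j := fun h => hi (h ▸ hj)
        exact ⟨hX j (by simp [hj]) x hx.1,
          (hkeep j (by simp [hj]) i (by simp) hij x hx.1).2 hx.2⟩
      · exact fun j hj x hx => hinv j (by simp [hj]) x (Finset.mem_filter.1 hx).1
      · exact fun j hj x hx => htoggle j (by simp [hj]) x (Finset.mem_filter.1 hx).1
      · exact fun j hj l hl hne x hx =>
          hkeep j (by simp [hj]) l (by simp [hl]) hne x (Finset.mem_filter.1 hx).1
    have hsum := Finset.card_filter_add_card_filter_not (s := X) (P i)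
    rw [Finset.card_insert_of_notMem hi, ← hsum, ← hcard, ← two_mul, pow_succ']
    exact mul_dvd_mul_left 2 hdvd

/-- Perfect matchings correspond to involutions sending every vertex to a neighbour. -/
theorem matchCount_eq_card_involutive {V : Type*} (G : SimpleGraph V) :
    matchCount G = Nat.card {f : V → V // Involutive f ∧ ∀ v, G.Adj v (f v)} := by
  symm
  refine Nat.card_eq_of_bijective (fun f => ⟨
    { verts := Set.univ
      Adj := fun u v => f.1 u = v
      adj_sub := fun {u v} h => h ▸ f.2.2 u
      edge_vert := fun _ => Set.mem_univ _
      symm := ⟨fun u v h => h ▸ f.2.1 u⟩ }, ?_⟩) ⟨?_, ?_⟩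
  · rw [SimpleGraph.Subgraph.isPerfectMatching_iff]
    exact fun v => ⟨f.1 v, rfl, fun w hw => Eq.symm hw⟩
  · intro f g h
    ext v
    have h' := congrArg (fun M : {M : G.Subgraph // M.IsPerfectMatching} => M.1.Adj v (f.1 v)) h
    exact Eq.symm (h'.mp rfl)
  · rintro ⟨M, hM⟩
    have hM' := SimpleGraph.Subgraph.isPerfectMatching_iff.1 hM
    choose f hf hfu using hM'
    refine ⟨⟨f, fun v => (hfu (f v) v (hf v).symm).symm, fun v => (hf v).adj_sub⟩, ?_⟩
    apply Subtype.ext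
    refine SimpleGraph.Subgraph.ext ?_ ?_
    · exact (Set.eq_univ_of_forall hM.2).symm
    · ext u v
      exact ⟨fun h => h ▸ hf u, fun h => (hfu u v h).symm⟩

section Flip

variable {V : Type*}

/-- The partition into orbits of the group generated by `f` and `ρ`. -/
def pairSetoid (ρ f : V → V) : Setoid V :=
  Relation.EqvGen.setoid (fun u v => v = f u ∨ v = ρ u)

theorem pairSetoid_left (ρ f : V → V) (v : V) : pairSetoid ρ f v (f v) :=
  Relation.EqvGen.rel _ _ (Or.inl rfl)

theorem pairSetoid_right (ρ f : V → V) (v : V) : pairSetoid ρ f v (ρ v) :=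
  Relation.EqvGen.rel _ _ (Or.inr rfl)

open Classical in
/-- Conjugate `f` by `ρ` on the set `T`. -/
noncomputable def flipOn (ρ : V → V) (T : Set V) (f : V → V) (v : V) : V :=
  if v ∈ T then ρ (f (ρ v)) else f v

theorem flipOn_of_mem {ρ f : V → V} {T : Set V} {v : V} (h : v ∈ T) :
    flipOn ρ T f v = ρ (f (ρ v)) := if_pos h

theorem flipOn_of_notMem {ρ f : V → V} {T : Set V} {v : V} (h : v ∉ T) :
    flipOn ρ T f v = f v := if_neg h

variable {ρ f : V → V} {T : Set V}

theorem flipOn_mem_iff (hρT : ∀ v, ρ v ∈ T ↔ v ∈ T) (hfT : ∀ v, f v ∈ T ↔ v ∈ T) (v : V) :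
    flipOn ρ T f v ∈ T ↔ v ∈ T := by
  by_cases h : v ∈ T
  · simp [flipOn_of_mem h, hρT, hfT]
  · simp [flipOn_of_notMem h, hfT]

theorem flipOn_involutive (hρ : Involutive ρ) (hf : Involutive f)
    (hρT : ∀ v, ρ v ∈ T ↔ v ∈ T) (hfT : ∀ v, f v ∈ T ↔ v ∈ T) :
    Involutive (flipOn ρ T f) := by
  intro v
  have hmem := flipOn_mem_iff hρT hfT v
  by_cases h : v ∈ T
  · rw [flipOn_of_mem (hmem.2 h), flipOn_of_mem h, hρ, hf, hρ]
  · rw [flipOn_of_notMem (mt hmem.1 h), flipOn_of_notMem h, hf]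

theorem flipOn_flipOn (hρ : Involutive ρ) (hρT : ∀ v, ρ v ∈ T ↔ v ∈ T) :
    flipOn ρ T (flipOn ρ T f) = f := by
  ext v
  by_cases h : v ∈ T
  · rw [flipOn_of_mem h, flipOn_of_mem ((hρT v).2 h), hρ, hρ]
  · rw [flipOn_of_notMem h, flipOn_of_notMem h]

theorem pairSetoid_flipOn_le : pairSetoid ρ (flipOn ρ T f) ≤ pairSetoid ρ f := by
  refine Setoid.eqvGen_le ?_
  rintro u v (rfl | rfl)
  · by_cases h : u ∈ T
    · rw [flipOn_of_mem h]
      exact Setoid.trans' _ (Setoid.trans' _ (pairSetoid_right ρ f u) (pairSetoid_left ρ f _))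
        (pairSetoid_right ρ f _)
    · rw [flipOn_of_notMem h]
      exact pairSetoid_left ρ f u
  · exact pairSetoid_right ρ f u

theorem pairSetoid_flipOn (hρ : Involutive ρ) (hρT : ∀ v, ρ v ∈ T ↔ v ∈ T) :
    pairSetoid ρ (flipOn ρ T f) = pairSetoid ρ f := by
  refine le_antisymm pairSetoid_flipOn_le ?_
  conv_lhs => rw [← flipOn_flipOn (f := f) hρ hρT]
  exact pairSetoid_flipOn_le

/-- If `σ` and `τ` are involutions, then `σ` inverts the powers of `σ * τ` applied to a fixed
point of `σ`. -/
theorem apply_zpow_mul_apply {σ τ : Equiv.Perm V} (hσ : σ * σ = 1) (hτ : τ * τ = 1)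
    {a : V} (ha : σ a = a) (n : ℤ) : σ (((σ * τ) ^ n) a) = ((σ * τ) ^ (-n)) a := by
  have hinv : (σ * τ)⁻¹ = τ * σ := by
    rw [mul_inv_rev, inv_eq_of_mul_eq_one_left hσ, inv_eq_of_mul_eq_one_left hτ]
  have hsemi : SemiconjBy σ (σ * τ) (σ * τ)⁻¹ := by
    rw [hinv, SemiconjBy, mul_assoc τ, hσ, mul_one, ← mul_assoc, hσ, one_mul]
  have h := hsemi.zpow_right n
  rw [inv_zpow', SemiconjBy] at h
  simpa only [Equiv.Perm.mul_apply, ha] using congrArg (fun p : Equiv.Perm V => p a) h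

/-- The orbit of a fixed point of `σ` under the group generated by the involutions `σ` and `τ`
is its orbit under the powers of `σ * τ`. -/
theorem exists_zpow_iff_of_pairSetoid {σ τ : Equiv.Perm V} (hσ : σ * σ = 1) (hτ : τ * τ = 1)
    {a u v : V} (ha : σ a = a) (huv : pairSetoid σ τ u v) :
    (∃ n : ℤ, ((σ * τ) ^ n) a = u) ↔ ∃ n : ℤ, ((σ * τ) ^ n) a = v := by
  have hσstep (u : V) (h : ∃ n : ℤ, ((σ * τ) ^ n) a = u) :
      ∃ n : ℤ, ((σ * τ) ^ n) a = σ u := by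
    obtain ⟨n, rfl⟩ := h
    exact ⟨-n, (apply_zpow_mul_apply hσ hτ ha n).symm⟩
  have hσσ (u : V) : σ (σ u) = u := by rw [← Equiv.Perm.mul_apply, hσ, Equiv.Perm.one_apply]
  have hττ (u : V) : τ (τ u) = u := by rw [← Equiv.Perm.mul_apply, hτ, Equiv.Perm.one_apply]
  have hτstep (u : V) (h : ∃ n : ℤ, ((σ * τ) ^ n) a = u) :
      ∃ n : ℤ, ((σ * τ) ^ n) a = τ u := by
    obtain ⟨n, rfl⟩ := h
    have heq : τ (((σ * τ) ^ n) a) = σ (((σ * τ) ^ (1 + n)) a) := by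
      rw [zpow_add, zpow_one, Equiv.Perm.mul_apply, Equiv.Perm.mul_apply, hσσ]
    rw [heq]
    exact hσstep _ ⟨_, rfl⟩
  induction huv with
  | rel u v h =>
    rcases h with rfl | rfl
    · exact ⟨hτstep u, fun h => by simpa only [hττ] using hτstep _ h⟩
    · exact ⟨hσstep u, fun h => by simpa only [hσσ] using hσstep _ h⟩
  | refl => rfl
  | symm _ _ _ ih => exact ih.symm
  | trans _ _ _ _ _ ih₁ ih₂ => exact ih₁.trans ih₂

/-- An orbit of the group generated by two involutions `ρ` and `f` contains at most two fixed
points of `ρ`. -/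
theorem eq_or_eq_or_eq_of_pairSetoid (hρ : Involutive ρ) (hf : Involutive f)
    {a b c : V} (ha : ρ a = a) (hb : ρ b = b) (hc : ρ c = c)
    (hab : pairSetoid ρ f a b) (hac : pairSetoid ρ f a c) : a = b ∨ a = c ∨ b = c := by
  let σ : Equiv.Perm V := hρ.toPerm
  let τ : Equiv.Perm V := hf.toPerm
  have hσ : σ * σ = 1 := Equiv.ext hρ
  have hτ : τ * τ = 1 := Equiv.ext hf
  have hself : ∃ n : ℤ, ((σ * τ) ^ n) a = a := ⟨0, rfl⟩
  obtain ⟨i, hi⟩ := (exists_zpow_iff_of_pairSetoid hσ hτ ha hab).1 hself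
  obtain ⟨j, hj⟩ := (exists_zpow_iff_of_pairSetoid hσ hτ ha hac).1 hself
  have hperiod (n : ℤ) : ((σ * τ) ^ n) a = a ↔
      ((minimalPeriod ((σ * τ) • ·) a : ℕ) : ℤ) ∣ n :=
    MulAction.zpow_smul_eq_iff_minimalPeriod_dvd (a := σ * τ) (b := a)
  have hdouble (n : ℤ) (u : V) (hu : ρ u = u) (hn : ((σ * τ) ^ n) a = u) :
      ((minimalPeriod ((σ * τ) • ·) a : ℕ) : ℤ) ∣ 2 * n := by
    have h : ((σ * τ) ^ (-n)) a = u := by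
      rw [← apply_zpow_mul_apply hσ hτ ha, hn]
      exact hu
    rw [← hperiod, two_mul, zpow_add, Equiv.Perm.mul_apply, hn, ← h, ← Equiv.Perm.mul_apply,
      ← zpow_add, add_neg_cancel, zpow_zero, Equiv.Perm.one_apply]
  obtain ⟨p, hp⟩ := hdouble i b hb hi
  obtain ⟨q, hq⟩ := hdouble j c hc hj
  rcases Int.even_or_odd' p with ⟨p', rfl | rfl⟩
  · exact Or.inl (((hperiod i).2 ⟨p', by linarith⟩).symm.trans hi)
  rcases Int.even_or_odd' q with ⟨q', rfl | rfl⟩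
  · exact Or.inr (Or.inl (((hperiod j).2 ⟨q', by linarith⟩).symm.trans hj))
  · have hij : ((σ * τ) ^ (-j + i)) a = a := (hperiod _).2 ⟨p' - q', by linarith⟩
    refine Or.inr (Or.inr ?_)
    rw [zpow_add, Equiv.Perm.mul_apply, hi, zpow_neg, Equiv.Perm.inv_eq_iff_eq, hj] at hij
    exact hij

end Flip

/-- Let `ρ` be an involutive symmetry of `G` whose fixed vertices are pairwise nonadjacent and at
least `2 * r` in number. If every edge of `S` meets `B`, then `2 ^ (r - #B)` divides the
number of perfect matchings of `G` without the edges of `S`. -/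
theorem two_pow_dvd_matchCount_deleteEdges {V : Type*} [Fintype V] [DecidableEq V]
    (G : SimpleGraph V) {ρ : V → V} (hρ : Involutive ρ)
    (hG : ∀ u v, G.Adj u v → G.Adj (ρ u) (ρ v))
    (hfix : ∀ u v, ρ u = u → ρ v = v → ¬ G.Adj u v)
    {r : ℕ} (hr : 2 * r ≤ (Finset.univ.filter (fun v => ρ v = v)).card)
    (S : Set (Sym2 V)) (B : Finset V) (hS : ∀ e ∈ S, ∃ b ∈ B, b ∈ e) :
    2 ^ (r - B.card) ∣ matchCount (G.deleteEdges S) := by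
  classical
  rw [matchCount_eq_card_involutive, Nat.card_eq_fintype_card, Fintype.card_subtype,
    Finset.card_eq_sum_card_image (pairSetoid ρ)]
  refine Finset.dvd_sum fun s hs => ?_
  obtain ⟨f₀, hf₀, rfl⟩ := Finset.mem_image.1 hs
  rw [Finset.mem_filter] at hf₀
  set s := pairSetoid ρ f₀ with hsdef
  set A := Finset.univ.filter (fun v => ρ v = v) with hA
  let L : Finset (Quotient s) := A.image (Quotient.mk s) \ B.image (Quotient.mk s)
  have hL : r - B.card ≤ L.card := by
    have htwo : A.card ≤ 2 * (A.image (Quotient.mk s)).card := by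
      refine Finset.card_le_mul_card_image _ 2 fun q _ => ?_
      by_contra! hlt
      obtain ⟨a, ha, b, hb, c, hc, hab, hac, hbc⟩ := Finset.two_lt_card.1 hlt
      simp only [hA, Finset.mem_filter, Finset.mem_univ, true_and] at ha hb hc
      have := eq_or_eq_or_eq_of_pairSetoid hρ hf₀.2.1 ha.1 hb.1 hc.1
        (Quotient.exact (ha.2.trans hb.2.symm)) (Quotient.exact (ha.2.trans hc.2.symm))
      tauto
    have hB : (B.image (Quotient.mk s)).card ≤ B.card := Finset.card_image_le
    have hdiff := Finset.le_card_sdiff (B.image (Quotient.mk s)) (A.image (Quotient.mk s))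
    change _ ≤ L.card at hdiff
    omega
  have hrep : ∀ q : Quotient s, ∃ a : V, q ∈ L → ρ a = a ∧ Quotient.mk s a = q := by
    intro q
    by_cases hq : q ∈ L
    · obtain ⟨a, ha, hqa⟩ := Finset.mem_image.1 (Finset.mem_sdiff.1 hq).1
      exact ⟨a, fun _ => ⟨(Finset.mem_filter.1 ha).2, hqa⟩⟩
    · exact ⟨q.out, fun h => absurd h hq⟩
  choose a ha using hrep
  refine (pow_dvd_pow 2 hL).trans ?_
  let e := Fintype.equivFin V
  let T (q : Quotient s) : Set V := {v | Quotient.mk s v = q}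
  have hρmem (q : Quotient s) (v : V) : Quotient.mk s (ρ v) = q ↔ Quotient.mk s v = q := by
    rw [Quotient.sound (pairSetoid_right ρ f₀ v)]
  have hfmem {f : V → V} (hf : pairSetoid ρ f = s) (q : Quotient s) (v : V) :
      Quotient.mk s (f v) = q ↔ Quotient.mk s v = q := by
    have h : s v (f v) := hf ▸ pairSetoid_left ρ f v
    rw [Quotient.sound h]
  refine two_pow_card_dvd_of_toggle (fun q f => e (f (a q)) < e (ρ (f (a q))))
    (fun q => flipOn ρ (T q)) L _ ?_ ?_ ?_ ?_
  · intro q hq f hf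
    simp only [Finset.mem_filter, Finset.mem_univ, true_and] at hf ⊢
    obtain ⟨⟨hinv, hadj⟩, hfs⟩ := hf
    refine ⟨⟨flipOn_involutive hρ hinv (hρmem q) (hfmem hfs q), fun v => ?_⟩,
      (pairSetoid_flipOn hρ (hρmem q)).trans hfs⟩
    by_cases hv : v ∈ T q
    · have hmem := (flipOn_mem_iff (T := T q) (hρmem q) (hfmem hfs q) v).2 hv
      rw [SimpleGraph.deleteEdges_adj]
      refine ⟨?_, fun hvS => ?_⟩
      · rw [flipOn_of_mem hv]
        simpa only [hρ v] using hG _ _ (SimpleGraph.deleteEdges_adj.1 (hadj (ρ v))).1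
      · obtain ⟨b, hbB, hb⟩ := hS _ hvS
        refine (Finset.mem_sdiff.1 hq).2 (Finset.mem_image.2 ⟨b, hbB, ?_⟩)
        rcases Sym2.mem_iff.1 hb with rfl | rfl
        · exact hv
        · exact hmem
    · rw [flipOn_of_notMem hv]
      exact hadj v
  · exact fun q _ f _ => flipOn_flipOn hρ (hρmem q)
  · intro q hq f hf
    simp only [Finset.mem_filter, Finset.mem_univ, true_and] at hf
    obtain ⟨haρ, haq⟩ := ha q hq
    rw [flipOn_of_mem (show a q ∈ T q from haq), haρ, hρ, not_lt]
    have hne : e (ρ (f (a q))) ≠ e (f (a q)) := fun h =>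
      hfix _ _ haρ (e.injective h) (SimpleGraph.deleteEdges_adj.1 (hf.1.2 (a q))).1
    exact ⟨le_of_lt, fun h => lt_of_le_of_ne h hne⟩
  · intro q _ q' hq' hne f _
    have hmem : a q' ∉ T q := fun h => hne ((ha q' hq').2.symm.trans h)
    rw [flipOn_of_notMem hmem]

/-- Deleting `k` distinct edges of the step-diagonal (the edges joining `(x,x)` to
`(x+1,x)` for `x = 0, …, r−1`) from `R_{2r×2r}` leaves a graph whose number of perfect
matchings is divisible by `2^{r−k}`. -/
theorem step_diagonal_deletion (r k : ℕ) (hr : 1 ≤ r) (hk : k ≤ r)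
    (S : Finset (Sym2 (Fin (2 * r) × Fin (2 * r))))
    (hS : ∀ e ∈ S, ∃ x : ℕ, ∃ _hx : x < r,
      e = s(((⟨x, by omega⟩ : Fin (2 * r)), (⟨x, by omega⟩ : Fin (2 * r))),
            ((⟨x + 1, by omega⟩ : Fin (2 * r)), (⟨x, by omega⟩ : Fin (2 * r)))))
    (hcard : S.card = k) :
    2 ^ (r - k) ∣ matchCount ((gridGraph (2 * r) (2 * r)).deleteEdges ↑S) := by
  have hB : (S.image fun e => e.out.1).card ≤ k := hcard ▸ Finset.card_image_le
  refine (pow_dvd_pow 2 (Nat.sub_le_sub_left hB r)).trans ?_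
  refine two_pow_dvd_matchCount_deleteEdges (gridGraph (2 * r) (2 * r)) (ρ := Prod.swap)
    Prod.swap_swap ?_ ?_ ?_ _ _
    fun e he => ⟨_, Finset.mem_image_of_mem _ he, Sym2.out_fst_mem e⟩
  · simp only [gridGraph, SimpleGraph.fromRel_adj, Prod.forall, Prod.swap, ne_eq, Prod.mk.injEq]
    tauto
  · simp only [gridGraph, SimpleGraph.fromRel_adj, Prod.forall, Prod.swap, ne_eq, Prod.mk.injEq,
      Fin.ext_iff]
    omega
  · calc 2 * r = ((Finset.univ : Finset (Fin (2 * r))).image fun i => (i, i)).card := by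
          rw [Finset.card_image_of_injective _ fun i j h => (Prod.ext_iff.1 h).1, Finset.card_univ,
            Fintype.card_fin]
      _ ≤ _ := Finset.card_le_card fun v hv => by
          obtain ⟨i, -, rfl⟩ := Finset.mem_image.1 hv
          simp
end

section
/- Let G be a finite bipartite simple graph that possesses a nonempty channel, and let μ be a perfect matching of G. Then there exists a nonempty simple cycle S in G of even length such that every second edge of S lies in μ (the edges of S alternate between edges of μ and edges not in μ); consequently, the symmetric difference of μ with the edge set of S is a perfect matching of G distinct from μ. -/
open Function SimpleGraph

section ZigzagWalk

variable {V T : Type*} {G : SimpleGraph V} {x y : T → V} {f : T → T}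

/-- The walk `x t, y t, x (f t), y (f t), x (f (f t)), …` with `2 * n` edges, ending at `x u` for `u = f^[n] t`. -/
def zigzagWalk (hxy : ∀ t, G.Adj (x t) (y t)) (hyx : ∀ t, G.Adj (y t) (x (f t))) :
    (n : ℕ) → (t u : T) → f^[n] t = u → G.Walk (x t) (x u)
  | 0, _, _, h => Walk.nil.copy rfl (congrArg x h)
  | n + 1, t, u, h => .cons (hxy t) <| .cons (hyx t) <|
    zigzagWalk hxy hyx n (f t) u ((iterate_succ_apply f n t).symm.trans h)

variable (hxy : ∀ t, G.Adj (x t) (y t)) (hyx : ∀ t, G.Adj (y t) (x (f t)))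

lemma length_zigzagWalk (n : ℕ) (t u : T) (h : f^[n] t = u) :
    (zigzagWalk hxy hyx n t u h).length = 2 * n := by
  induction n generalizing t with
  | zero => simp [zigzagWalk]
  | succ n ih => simp [zigzagWalk, ih, mul_add]

lemma mem_edges_zigzagWalk {n : ℕ} {t u : T} {h : f^[n] t = u} {e : Sym2 V} :
    e ∈ (zigzagWalk hxy hyx n t u h).edges ↔
      ∃ i < n, e = s(x (f^[i] t), y (f^[i] t)) ∨ e = s(y (f^[i] t), x (f^[i + 1] t)) := by
  induction n generalizing t with
  | zero => simp [zigzagWalk]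
  | succ n ih =>
    simp only [zigzagWalk, Walk.edges_cons, List.mem_cons, ih]
    rw [Nat.exists_lt_succ_left]
    simp [or_assoc]

lemma mem_support_zigzagWalk {n : ℕ} {t u : T} {h : f^[n] t = u} {v : V}
    (hv : v ∈ (zigzagWalk hxy hyx n t u h).support) :
    (∃ i ≤ n, v = x (f^[i] t)) ∨ ∃ i < n, v = y (f^[i] t) := by
  induction n generalizing t with
  | zero => simpa [zigzagWalk] using hv
  | succ n ih =>
    simp only [zigzagWalk, Walk.support_cons, List.mem_cons] at hv
    rcases hv with rfl | rfl | hv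
    · exact .inl ⟨0, by simp, rfl⟩
    · exact .inr ⟨0, by simp, rfl⟩
    · rcases ih hv with ⟨i, hi, h⟩ | ⟨i, hi, h⟩
      · exact .inl ⟨i + 1, by lia, h⟩
      · exact .inr ⟨i + 1, by lia, h⟩

lemma get_edges_zigzagWalk_mem_iff {E : Set (Sym2 V)} (hE : ∀ t, s(x t, y t) ∈ E)
    (hE' : ∀ t, s(y t, x (f t)) ∉ E) (n : ℕ) (t u : T)
    (h : f^[n] t = u) (i : ℕ)
    (hi : i < (zigzagWalk hxy hyx n t u h).edges.length) :
    (zigzagWalk hxy hyx n t u h).edges[i] ∈ E ↔ Even i := by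
  induction n generalizing t i with
  | zero => simp [zigzagWalk] at hi
  | succ n ih =>
    match i with
    | 0 => simp [zigzagWalk, hE]
    | 1 => simp [zigzagWalk, hE']
    | i + 2 =>
      simp only [zigzagWalk, Walk.edges_cons, List.getElem_cons_succ]
      rw [ih]
      simp [Nat.even_add]

lemma isPath_zigzagWalk (hx : Injective x) (hy : Injective y) (hne : ∀ s t, x s ≠ y t)
    {n : ℕ} {t u : T} (h : f^[n] t = u) (hinj : Set.InjOn (f^[·] t) (Set.Iic n)) :
    (zigzagWalk hxy hyx n t u h).IsPath := by
  induction n generalizing t with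
  | zero => simp [zigzagWalk]
  | succ n ih =>
    have key : ∀ i ≤ n, f^[i] (f t) ≠ t := fun i hi h ↦ by
      have := @hinj (i + 1) (by simpa using hi) 0 (by simp) (by simpa using h)
      lia
    simp only [zigzagWalk, Walk.cons_isPath_iff]
    refine ⟨⟨ih _ fun i hi j hj h ↦ ?_, fun h ↦ ?_⟩, ?_⟩
    · have := @hinj (i + 1) (by simpa using hi) (j + 1) (by simpa using hj) h
      lia
    · rcases mem_support_zigzagWalk hxy hyx h with ⟨i, hi, h⟩ | ⟨i, hi, h⟩
      · exact hne _ _ h.symm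
      · exact key i hi.le (hy h).symm
    · simp only [Walk.support_cons, List.mem_cons, not_or]
      refine ⟨hne _ _, fun h ↦ ?_⟩
      rcases mem_support_zigzagWalk hxy hyx h with ⟨i, hi, h⟩ | ⟨i, hi, h⟩
      · exact key i hi (hx h).symm
      · exact hne _ _ h

lemma isCycle_zigzagWalk (hx : Injective x) (hy : Injective y)
    (hne : ∀ s t, x s ≠ y t) {n : ℕ} {t : T} (hft : f t ≠ t) (hn : minimalPeriod f t = n + 1)
    (h : f^[n + 1] t = t) :
    (zigzagWalk hxy hyx (n + 1) t t h).IsCycle := by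
  have hinj : Set.InjOn (f^[·] t) (Set.Iio (n + 1)) := hn ▸ iterate_injOn_Iio_minimalPeriod
  have hper : IsPeriodicPt f (n + 1) t := h
  have hinj' : Set.InjOn (f^[·] (f t)) (Set.Iic n) := by
    have : minimalPeriod f (f t) = n + 1 := by
      rw [minimalPeriod_apply ⟨n + 1, by lia, hper⟩, hn]
    intro i hi j hj hij
    exact iterate_injOn_Iio_minimalPeriod (f := f) (x := f t)
      (by simp [this] at hi ⊢; lia) (by simp [this] at hj ⊢; lia) hij
  have h' : f^[n] (f t) = t := (iterate_succ_apply f n t).symm.trans h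
  have hpath := isPath_zigzagWalk hxy hyx hx hy hne h' hinj'
  have hy_notMem : y t ∉ (zigzagWalk hxy hyx n (f t) t h').support := fun hm ↦ by
    rcases mem_support_zigzagWalk hxy hyx hm with ⟨i, hi, hi'⟩ | ⟨i, hi, hi'⟩
    · exact hne _ _ hi'.symm
    · have := @hinj (i + 1) (by simpa using hi) 0 (by simp) (by simpa using (hy hi').symm)
      lia
  rw [zigzagWalk, Walk.cons_isCycle_iff, Walk.cons_isPath_iff]
  refine ⟨⟨hpath, hy_notMem⟩, ?_⟩
  simp only [Walk.edges_cons, List.mem_cons, not_or]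
  refine ⟨fun he ↦ ?_, fun he ↦ hy_notMem (Walk.snd_mem_support_of_mem_edges _ he)⟩
  rw [Sym2.eq_swap, Sym2.congr_right] at he
  exact hft (hx he).symm

end ZigzagWalk

/-- The subgraph of `G` on all vertices with edge set `E`. -/
def spanningSubgraphOfEdges {V : Type*} (G : SimpleGraph V) (E : Set (Sym2 V))
    (hE : E ⊆ G.edgeSet) : G.Subgraph where
  verts := Set.univ
  Adj v w := s(v, w) ∈ E
  adj_sub h := hE h
  edge_vert _ := trivial
  symm := ⟨fun v w h ↦ by rwa [Sym2.eq_swap]⟩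

lemma edgeSet_spanningSubgraphOfEdges {V : Type*} (G : SimpleGraph V) (E : Set (Sym2 V))
    (hE : E ⊆ G.edgeSet) : (spanningSubgraphOfEdges G E hE).edgeSet = E := by
  ext e
  induction e with | _ v w => rfl

/-- Exchanging the edges `x t — y t` of a perfect matching for the edges `y t — x (f t)`, where `t`
ranges over a set permuted by `f`, gives a perfect matching. -/
lemma isPerfectMatching_symmDiff {V T : Type*} {G : SimpleGraph V} {x y : T → V} {f : T → T}
    {M : G.Subgraph} (hM : M.IsPerfectMatching) (hxy : ∀ t, M.Adj (x t) (y t))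
    (hft : ∀ t, f t ≠ t) (hx : Injective x) (hne : ∀ s t, x s ≠ y t)
    {P : Set T} (hP : Set.BijOn f P P) {F : Set (Sym2 V)}
    (hF : ∀ e, e ∈ F ↔ ∃ t ∈ P, e = s(x t, y t) ∨ e = s(y t, x (f t)))
    (hE : symmDiff M.edgeSet F ⊆ G.edgeSet) :
    (spanningSubgraphOfEdges G (symmDiff M.edgeSet F) hE).IsPerfectMatching := by
  rw [Subgraph.isPerfectMatching_iff] at hM ⊢
  have huniq : ∀ {v w w'}, M.Adj v w → M.Adj v w' → w = w' := fun h h' ↦ (hM _).unique h h'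
  have hnot : ∀ t, ¬ M.Adj (y t) (x (f t)) := fun t h ↦
    hft t (hx (huniq (hxy t).symm h)).symm
  have hyinj : Injective y := fun s t h ↦ hx (huniq (hxy s).symm (h ▸ (hxy t).symm))
  have hadj : ∀ v w, (spanningSubgraphOfEdges G (symmDiff M.edgeSet F) hE).Adj v w ↔
      (M.Adj v w ∧ s(v, w) ∉ F) ∨ (s(v, w) ∈ F ∧ ¬ M.Adj v w) := fun v w ↦ by
    change s(v, w) ∈ symmDiff M.edgeSet F ↔ _
    simp [Set.mem_symmDiff]
  intro v
  simp only [hadj]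
  by_cases hvx : ∃ t ∈ P, x (f t) = v
  · obtain ⟨t, ht, rfl⟩ := hvx
    refine ⟨y t, .inr ⟨(hF _).2 ⟨t, ht, .inr Sym2.eq_swap⟩, fun h ↦ hnot t h.symm⟩, ?_⟩
    rintro w (⟨h, hn⟩ | ⟨h, hn⟩)
    · obtain rfl := huniq h (hxy _)
      exact absurd ((hF _).2 ⟨f t, hP.mapsTo ht, .inl rfl⟩) hn
    · obtain ⟨r, hr, h | h⟩ := (hF _).1 h
      · rcases Sym2.eq_iff.1 h with ⟨h1, rfl⟩ | ⟨h1, -⟩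
        · exact absurd (h1 ▸ hxy r) hn
        · exact absurd h1 (hne _ _)
      · rcases Sym2.eq_iff.1 h with ⟨h1, -⟩ | ⟨h1, rfl⟩
        · exact absurd h1 (hne _ _)
        · rw [hP.injOn ht hr (hx h1)]
  by_cases hvy : ∃ t ∈ P, y t = v
  · obtain ⟨t, ht, rfl⟩ := hvy
    refine ⟨x (f t), .inr ⟨(hF _).2 ⟨t, ht, .inr rfl⟩, hnot t⟩, ?_⟩
    rintro w (⟨h, hn⟩ | ⟨h, hn⟩)
    · obtain rfl := huniq h (hxy _).symm
      exact absurd ((hF _).2 ⟨t, ht, .inl Sym2.eq_swap⟩) hn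
    · obtain ⟨r, hr, h | h⟩ := (hF _).1 h
      · rcases Sym2.eq_iff.1 h with ⟨h1, -⟩ | ⟨h1, rfl⟩
        · exact absurd h1.symm (hne _ _)
        · exact absurd (h1 ▸ (hxy r).symm) hn
      · rcases Sym2.eq_iff.1 h with ⟨h1, rfl⟩ | ⟨h1, -⟩
        · rw [hyinj h1]
        · exact absurd h1.symm (hne _ _)
  have hvF : ∀ w, s(v, w) ∉ F := fun w h ↦ by
    have hvx' : ∀ t ∈ P, x t ≠ v := fun t ht h ↦ by
      obtain ⟨r, hr, rfl⟩ := hP.surjOn ht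
      exact hvx ⟨r, hr, h⟩
    obtain ⟨r, hr, h | h⟩ := (hF _).1 h <;> rcases Sym2.eq_iff.1 h with ⟨h1, -⟩ | ⟨h1, -⟩
    · exact hvx' r hr h1.symm
    · exact hvy ⟨r, hr, h1.symm⟩
    · exact hvy ⟨r, hr, h1.symm⟩
    · exact hvx ⟨r, hr, h1.symm⟩
  simpa [hvF] using hM v

/-- The forward orbit of a periodic point is permuted by the map. -/
lemma bijOn_range_iterate {T : Type*} {f : T → T} {t : T} (ht : t ∈ periodicPts f) :
    Set.BijOn f (Set.range (f^[·] t)) (Set.range (f^[·] t)) := by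
  obtain ⟨n, hn, hper⟩ := ht
  refine ⟨?_, (bijOn_periodicPts f).injOn.mono ?_, ?_⟩
  · rintro _ ⟨i, rfl⟩
    exact ⟨i + 1, iterate_succ_apply' f i t⟩
  · rintro _ ⟨i, rfl⟩
    exact ⟨n, hn, hper.apply_iterate i⟩
  · rintro _ ⟨i, rfl⟩
    refine ⟨_, ⟨i + (n - 1), rfl⟩, ?_⟩
    change f (f^[i + (n - 1)] t) = f^[i] t
    rw [← iterate_succ_apply' f, show (i + (n - 1)).succ = i + n by lia, iterate_add_apply, hper]

lemma periodicPts_nonempty_of_finite {T : Type*} [Finite T] [Nonempty T] (f : T → T) :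
    (periodicPts f).Nonempty := by
  obtain ⟨t⟩ := ‹Nonempty T›
  obtain ⟨i, j, hij, h⟩ := Finite.exists_ne_map_eq_of_infinite (f^[·] t)
  wlog hlt : i < j generalizing i j
  · exact this j i hij.symm h.symm (by lia)
  refine ⟨f^[i] t, j - i, by lia, ?_⟩
  change f^[j - i] (f^[i] t) = f^[i] t
  rw [← iterate_add_apply, Nat.sub_add_cancel hlt.le]
  exact h.symm

/-- A neighbor of a vertex in a channel is accompanied by another one. -/
lemma IsChannel.exists_adj_ne {V : Type*} [Finite V] {G : SimpleGraph V} {C : Set V}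
    (hC : IsChannel G C) {v w : V} (hw : w ∈ C) (h : G.Adj v w) :
    ∃ w' ∈ C, G.Adj v w' ∧ w' ≠ w := by
  have hmem : w ∈ {w | w ∈ C ∧ G.Adj v w} := ⟨hw, h⟩
  have hcard : 1 < {w | w ∈ C ∧ G.Adj v w}.ncard := by
    have := (Set.ncard_pos (Set.toFinite _)).2 ⟨w, hmem⟩
    obtain ⟨k, hk⟩ := hC v
    lia
  obtain ⟨w', ⟨h1, h2⟩, h3⟩ := Set.exists_ne_of_one_lt_ncard hcard w
  exact ⟨w', h1, h2, h3⟩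

/-- If a finite bipartite graph has a nonempty channel, then any perfect matching `μ`
admits a simple cycle of even length whose edges alternate between `μ` and its complement,
and flipping this cycle yields a different perfect matching. -/
theorem exists_alternating_cycle_of_channel {V : Type*} [Fintype V] (G : SimpleGraph V)
    (color : V → Bool) (hcol : ∀ ⦃v w : V⦄, G.Adj v w → color v ≠ color w)
    (C : Set V) (hne : C.Nonempty) (hch : IsChannel G C)
    (μ : G.Subgraph) (hμ : μ.IsPerfectMatching) :
    ∃ (v : V) (c : G.Walk v v), c.IsCycle ∧ Even c.length ∧
      (∀ (i : ℕ) (h : i < c.edges.length),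
        (c.edges.get ⟨i, h⟩ ∈ μ.edgeSet ↔ Even i)) ∧
      ∃ μ' : G.Subgraph, μ'.IsPerfectMatching ∧
        μ'.edgeSet = symmDiff μ.edgeSet {e | e ∈ c.edges} ∧ μ' ≠ μ := by
  obtain ⟨v₀, hv₀⟩ := hne
  have hμ' := Subgraph.isPerfectMatching_iff.1 hμ
  choose m hm hm' using hμ'
  let T := {w : V // w ∈ C ∧ color w = color v₀}
  have : Nonempty T := ⟨⟨v₀, hv₀, rfl⟩⟩
  let x : T → V := Subtype.val
  let y : T → V := fun t ↦ m t
  have hstep : ∀ t : T, ∃ t' : T, G.Adj (y t) (x t') ∧ t' ≠ t := by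
    rintro ⟨w, hw, hcw⟩
    obtain ⟨w', hw', hadj, hne'⟩ := hch.exists_adj_ne hw (hm w).adj_sub.symm
    refine ⟨⟨w', hw', ?_⟩, hadj, fun h ↦ hne' (congrArg Subtype.val h)⟩
    have h1 := hcol hadj
    have h2 := hcol (hm w).adj_sub
    rw [← hcw]
    exact (Bool.eq_not.2 h1.symm).trans (Bool.eq_not.2 h2).symm
  choose f hyx hft using hstep
  have hxyμ : ∀ t, μ.Adj (x t) (y t) := fun t ↦ hm t
  have hxy : ∀ t, G.Adj (x t) (y t) := fun t ↦ (hxyμ t).adj_sub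
  have hx : Injective x := Subtype.val_injective
  have hy : Injective y := fun s t h ↦
    hx ((hm' _ _ (hxyμ s).symm).trans (hm' _ _ (h ▸ (hxyμ t).symm)).symm)
  have hxney : ∀ s t, x s ≠ y t := fun s t h ↦
    hcol (hxy t) (h ▸ t.2.2.trans s.2.2.symm)
  obtain ⟨t, ht⟩ := periodicPts_nonempty_of_finite f
  obtain ⟨n, hn⟩ := Nat.exists_eq_succ_of_ne_zero (minimalPeriod_pos_of_mem_periodicPts ht).ne'
  have hper : f^[n + 1] t = t := by
    simpa only [hn] using iterate_minimalPeriod (f := f) (x := t)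
  let c : G.Walk (x t) (x t) := zigzagWalk hxy hyx (n + 1) t t hper
  have hF : ∀ e, e ∈ {e | e ∈ c.edges} ↔
      ∃ s ∈ Set.range (f^[·] t), e = s(x s, y s) ∨ e = s(y s, x (f s)) := fun e ↦ by
    simp only [c, Set.mem_ofPred_eq, mem_edges_zigzagWalk]
    constructor
    · rintro ⟨i, -, hi⟩
      exact ⟨_, ⟨i, rfl⟩, by rwa [iterate_succ_apply'] at hi⟩
    · rintro ⟨_, ⟨i, rfl⟩, hi⟩
      have hmod : f^[i % (n + 1)] t = f^[i] t := IsPeriodicPt.iterate_mod_apply hper i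
      refine ⟨i % (n + 1), Nat.mod_lt _ n.succ_pos, ?_⟩
      rwa [iterate_succ_apply', hmod]
  have hE : symmDiff μ.edgeSet {e | e ∈ c.edges} ⊆ G.edgeSet := fun e he ↦
    he.elim (fun h ↦ μ.edgeSet_subset h.1) fun h ↦ c.edges_subset_edgeSet h.1
  refine ⟨x t, c, isCycle_zigzagWalk hxy hyx hx hy hxney (hft t) hn hper, ?_, ?_,
    spanningSubgraphOfEdges G _ hE,
    isPerfectMatching_symmDiff hμ hxyμ hft hx hxney (bijOn_range_iterate ht) hF hE,
    edgeSet_spanningSubgraphOfEdges _ _ _, fun heq ↦ ?_⟩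
  · simp [c, length_zigzagWalk]
  · intro i hi
    simp only [c, List.get_eq_getElem]
    refine get_edges_zigzagWalk_mem_iff hxy hyx (E := μ.edgeSet) hxyμ (fun s h ↦ ?_) _ _ _ _ _ _
    exact hft s (hx ((hm' _ _ h).trans (hm' _ _ (hxyμ s).symm).symm))
  · have hedge : s(x t, y t) ∈ μ.edgeSet := hxyμ t
    have hmem := hedge
    rw [← heq, edgeSet_spanningSubgraphOfEdges, Set.mem_symmDiff] at hmem
    have hc : s(x t, y t) ∈ {e | e ∈ c.edges} := (hF _).2 ⟨t, ⟨0, rfl⟩, .inl rfl⟩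
    exact hmem.elim (fun h ↦ h.2 hc) fun h ↦ h.2 hedge
end

section
/- Let G be a finite bipartite simple graph with a fixed proper 2-coloring into black and white, and fix an edge e of G with black endpoint b and white endpoint w. Let G^e be G with the edge e deleted and G′ the induced subgraph of G on all vertices other than b and w. Then: (i) the channels of G consisting only of black vertices and not containing b are exactly the channels of G^e consisting only of black vertices and not containing b; (ii) if there exists a channel of G^e consisting only of black vertices that contains b, then |C_B(G)| = |C_B(G′)|. -/
/-- `C` meets the neighborhood of `v` in an even number of vertices. -/
def EvenAt {V : Type*} (G : SimpleGraph V) (C : Set V) (v : V) : Prop :=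
  Even {u | u ∈ C ∧ G.Adj v u}.ncard

theorem Set.even_ncard_symmDiff {α : Type*} [Finite α] (S T : Set α) :
    Even (symmDiff S T).ncard ↔ (Even S.ncard ↔ Even T.ncard) := by
  have hd : (symmDiff S T).ncard = (S \ T).ncard + (T \ S).ncard := by
    rw [Set.symmDiff_def, Set.ncard_union_eq disjoint_sdiff_sdiff]
  have hS := Set.ncard_inter_add_ncard_sdiff_eq_ncard S T
  have hT := Set.ncard_inter_add_ncard_sdiff_eq_ncard T S
  rw [Set.inter_comm] at hT
  rw [hd, ← hS, ← hT]
  simp only [Nat.even_add]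
  tauto

namespace EvenAt

variable {V : Type*} {G : SimpleGraph V} {color : V → Bool} {b w : V}

theorem symmDiff_iff [Finite V] (C D : Set V) (v : V) :
    EvenAt G (symmDiff C D) v ↔ (EvenAt G C v ↔ EvenAt G D v) := by
  unfold EvenAt
  rw [← Set.even_ncard_symmDiff]
  congr! 2
  ext u
  simp only [Set.mem_ofPred_eq, Set.mem_symmDiff]
  tauto

theorem of_black (hcol : ∀ ⦃v w : V⦄, G.Adj v w → color v ≠ color w) {C : Set V}
    (hC : ∀ v ∈ C, color v = true) {v : V} (hv : color v = true) : EvenAt G C v := by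
  have : {u | u ∈ C ∧ G.Adj v u} = ∅ := by
    ext u
    simp only [Set.mem_ofPred_eq, Set.mem_empty_iff_false, iff_false, not_and]
    exact fun hu h => hcol h (by rw [hv, hC u hu])
  simp [EvenAt, this]

theorem deleteEdges_iff {C : Set V} (hwC : w ∉ C) {v : V} (h : v ≠ w ∨ b ∉ C) :
    EvenAt (G.deleteEdges {s(b, w)}) C v ↔ EvenAt G C v := by
  unfold EvenAt
  congr! 3
  ext u
  simp only [SimpleGraph.deleteEdges_adj, Set.mem_singleton_iff, Sym2.eq_iff,
    and_congr_right_iff, and_iff_left_iff_imp]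
  rintro hu - (⟨rfl, rfl⟩ | ⟨rfl, rfl⟩)
  · exact hwC hu
  · exact h.elim (· rfl) (· hu)

theorem not_of_deleteEdges [Finite V] (hadj : G.Adj b w) {C : Set V} (hbC : b ∈ C)
    (h : EvenAt (G.deleteEdges {s(b, w)}) C w) : ¬ EvenAt G C w := by
  have hins : {u | u ∈ C ∧ G.Adj w u} =
      insert b {u | u ∈ C ∧ (G.deleteEdges {s(b, w)}).Adj w u} := by
    ext u
    by_cases hub : u = b
    · simp [hub, hbC, hadj.symm]
    · simp +contextual [hub, hadj.ne']
  have hnot : b ∉ {u | u ∈ C ∧ (G.deleteEdges {s(b, w)}).Adj w u} := by simp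
  unfold EvenAt at h ⊢
  rw [hins, Set.ncard_insert_of_notMem hnot, Nat.even_add_one]
  exact not_not.mpr h

theorem induce_iff {s : Set V} (C : Set s) (v : s) :
    EvenAt (G.induce s) C v ↔ EvenAt G (Subtype.val '' C) v := by
  unfold EvenAt
  rw [← Set.ncard_image_of_injective _ Subtype.val_injective]
  congr! 2
  ext u
  simp

end EvenAt

theorem black_subset_compl {V : Type*} {color : V → Bool} {b w : V} (hw : color w = false)
    {D : Set V} (hD : ∀ v ∈ D, color v = true) (hbD : b ∉ D) : D ⊆ ({b, w}ᶜ : Set V) := by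
  intro u hu
  have hub : u ≠ b := fun h => hbD (h ▸ hu)
  have huw : u ≠ w := fun h => by simpa [h, hw] using hD u hu
  simp [hub, huw]

/-- Black channels of `G - {b, w}` are the black sets of vertices of `G` avoiding `b` that have
even intersection with every neighborhood except possibly that of `w`. -/
def inducedChannelEquiv {V : Type*} {G : SimpleGraph V}
    {color : V → Bool} (hcol : ∀ ⦃v w : V⦄, G.Adj v w → color v ≠ color w)
    {b w : V} (hb : color b = true) (hw : color w = false) :
    {C : Set ↥({b, w}ᶜ : Set V) //
      IsChannel (G.induce ({b, w}ᶜ : Set V)) C ∧ ∀ v ∈ C, color v.val = true} ≃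
    {D : Set V // (∀ v ≠ w, EvenAt G D v) ∧ (∀ v ∈ D, color v = true) ∧ b ∉ D} where
  toFun C := ⟨Subtype.val '' C.1, by
    obtain ⟨C, hC, hblack⟩ := C
    have hblack' : ∀ v ∈ Subtype.val '' C, color v = true := by
      rintro _ ⟨v, hv, rfl⟩
      exact hblack v hv
    refine ⟨fun v hvw => ?_, hblack', by simp⟩
    by_cases hvb : v = b
    · exact EvenAt.of_black hcol hblack' (hvb ▸ hb)
    · exact (EvenAt.induce_iff C ⟨v, by simp [hvb, hvw]⟩).1 (hC _)⟩
  invFun D := ⟨Subtype.val ⁻¹' D.1, by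
    obtain ⟨D, hD, hblack, hbD⟩ := D
    refine ⟨fun v => (EvenAt.induce_iff _ v).2 ?_, fun v hv => hblack v hv⟩
    rw [Subtype.image_preimage_coe, Set.inter_eq_right.2 (black_subset_compl hw hblack hbD)]
    exact hD v fun h => v.2 (by simp [h])⟩
  left_inv C := Subtype.ext (Set.preimage_image_eq _ Subtype.val_injective)
  right_inv D := by
    obtain ⟨D, hD, hblack, hbD⟩ := D
    refine Subtype.ext ?_
    change Subtype.val '' (Subtype.val ⁻¹' D) = D
    rw [Subtype.image_preimage_coe, Set.inter_eq_right.2 (black_subset_compl hw hblack hbD)]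

theorem black_symmDiff {V : Type*} {color : V → Bool} {C D : Set V}
    (hC : ∀ v ∈ C, color v = true) (hD : ∀ v ∈ D, color v = true) :
    ∀ v ∈ symmDiff C D, color v = true := by
  rintro v (h | h)
  exacts [hC v h.1, hD v h.1]

open Classical in
/-- Adding a black set `B ∋ b` whose only odd neighborhood is that of `w` exchanges the condition
of being even at `w` for that of avoiding `b`. -/
noncomputable def channelToggleEquiv {V : Type*} [Finite V] {G : SimpleGraph V}
    {color : V → Bool} {b w : V} {B : Set V} (hB : ∀ v ≠ w, EvenAt G B v)
    (hBw : ¬ EvenAt G B w) (hBblack : ∀ v ∈ B, color v = true) (hbB : b ∈ B) :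
    {C : Set V // IsChannel G C ∧ ∀ v ∈ C, color v = true} ≃
    {D : Set V // (∀ v ≠ w, EvenAt G D v) ∧ (∀ v ∈ D, color v = true) ∧ b ∉ D} where
  toFun C := ⟨if b ∈ C.1 then symmDiff C.1 B else C.1, by
    obtain ⟨C, hC, hblack⟩ := C
    split_ifs with h
    · exact ⟨fun v hv => (EvenAt.symmDiff_iff C B v).2 (iff_of_true (hC v) (hB v hv)),
        black_symmDiff hblack hBblack, by simp_all [Set.mem_symmDiff]⟩
    · exact ⟨fun v _ => hC v, hblack, h⟩⟩
  invFun D := ⟨if EvenAt G D.1 w then D.1 else symmDiff D.1 B, by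
    obtain ⟨D, hD, hblack, hbD⟩ := D
    split_ifs with h
    · exact ⟨fun v => if hv : v = w then hv ▸ h else hD v hv, hblack⟩
    · refine ⟨fun v => (EvenAt.symmDiff_iff D B v).2 ?_, black_symmDiff hblack hBblack⟩
      by_cases hv : v = w
      · exact hv ▸ iff_of_false h hBw
      · exact iff_of_true (hD v hv) (hB v hv)⟩
  left_inv C := by
    obtain ⟨C, hC, hblack⟩ := C
    have hCw : EvenAt G C w := hC w
    refine Subtype.ext ?_
    by_cases h : b ∈ C
    · simp [h, EvenAt.symmDiff_iff, hCw, hBw]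
    · simp [h, hCw]
  right_inv D := by
    obtain ⟨D, hD, hblack, hbD⟩ := D
    refine Subtype.ext ?_
    by_cases h : EvenAt G D w
    · simp [h, hbD]
    · simp [h, Set.mem_symmDiff, hbD, hbB]

/-- Channel Routing Lemma. For an edge `e = bw` (`b` black, `w` white):
(i) the channels of `G` on black vertices avoiding `b` are exactly those of `G − e`
avoiding `b`; (ii) if `G − e` has a channel on black vertices containing `b`, then
`|C_B(G)| = |C_B(G − {b,w})|`. -/
theorem channel_routing {V : Type*} [Fintype V] [DecidableEq V] (G : SimpleGraph V)
    (color : V → Bool) (hcol : ∀ ⦃v w : V⦄, G.Adj v w → color v ≠ color w)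
    (b w : V) (hadj : G.Adj b w) (hb : color b = true) (hw : color w = false) :
    (∀ C : Set V,
      (IsChannel G C ∧ (∀ v ∈ C, color v = true) ∧ b ∉ C) ↔
        (IsChannel (G.deleteEdges {s(b, w)}) C ∧ (∀ v ∈ C, color v = true) ∧ b ∉ C)) ∧
    ((∃ B : Set V, IsChannel (G.deleteEdges {s(b, w)}) B ∧
        (∀ v ∈ B, color v = true) ∧ b ∈ B) →
      Nat.card {C : Set V // IsChannel G C ∧ ∀ v ∈ C, color v = true} =
        Nat.card {C : Set ↥({b, w}ᶜ : Set V) //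
          IsChannel (G.induce ({b, w}ᶜ : Set V)) C ∧ ∀ v ∈ C, color v.val = true}) := by
  have notMem : ∀ {C : Set V}, (∀ v ∈ C, color v = true) → w ∉ C := fun hC h => by
    simpa [hw] using hC w h
  refine ⟨fun C => and_congr_left fun ⟨hC, hbC⟩ => forall_congr' fun v =>
    (EvenAt.deleteEdges_iff (notMem hC) (Or.inr hbC)).symm, ?_⟩
  rintro ⟨B, hB, hBblack, hbB⟩
  exact Nat.card_congr ((channelToggleEquiv
    (fun v hv => (EvenAt.deleteEdges_iff (notMem hBblack) (Or.inl hv)).1 (hB v))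
    (EvenAt.not_of_deleteEdges hadj hbB (hB w)) hBblack hbB).trans
    (inducedChannelEquiv hcol hb hw).symm)
end

section
/- For all integers m, n ≥ 1, the number of perfect matchings of the grid graph R_{(m−1)×(n−1)} is divisible by 2^{⌊(gcd(m,n)−1)/2⌋}. -/
open Finset

theorem Matrix.two_pow_card_dvd_det_of_isUnit_det {ι : Type*} [Fintype ι] [DecidableEq ι]
    (A P : Matrix ι ι ℤ) (T : Finset ι) (hP : IsUnit P.det)
    (hAP : ∀ i, ∀ j ∈ T, 2 ∣ (A * P) i j) : 2 ^ #T ∣ A.det := by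
  have hdiv : ∀ i j, ∃ q, (A * P) i j = q * (if j ∈ T then 2 else 1) := by
    intro i j
    by_cases hj : j ∈ T
    · obtain ⟨q, hq⟩ := hAP i j hj
      exact ⟨q, by rw [hq, if_pos hj, mul_comm]⟩
    · exact ⟨(A * P) i j, by simp [hj]⟩
  choose Q hQ using hdiv
  have hfac : A * P = Matrix.of Q * Matrix.diagonal fun j => if j ∈ T then 2 else 1 := by
    ext i j
    rw [Matrix.mul_diagonal, hQ, Matrix.of_apply]
  have hdet : A.det * P.det = (Matrix.of Q).det * 2 ^ #T := by
    rw [← Matrix.det_mul, hfac, Matrix.det_mul, Matrix.det_diagonal]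
    simp
  exact (hP.dvd_mul_right).1 ⟨_, hdet.trans (mul_comm _ _)⟩

theorem Matrix.isUnit_det_of_eq_one_on {ι : Type*} [Fintype ι] [DecidableEq ι]
    (P : Matrix ι ι ℤ) (T : Finset ι) (hout : ∀ i, ∀ j ∉ T, P i j = (1 : Matrix ι ι ℤ) i j)
    (hin : ∀ i ∈ T, ∀ j ∈ T, P i j = (1 : Matrix ι ι ℤ) i j) : IsUnit P.det := by
  have hsq : (P - 1) * (P - 1) = 0 := by
    ext i l
    rw [Matrix.mul_apply, Matrix.zero_apply]
    refine Finset.sum_eq_zero fun j _ => ?_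
    simp only [Matrix.sub_apply]
    by_cases hj : j ∈ T
    · by_cases hl : l ∈ T
      · simp [hin j hj l hl]
      · simp [hout j l hl]
    · simp [hout i j hj]
  have hinv : P * (2 - P) = 1 := by
    have : P * (2 - P) = 1 - (P - 1) * (P - 1) := by noncomm_ring
    rw [this, hsq, sub_zero]
  exact IsUnit.of_mul_eq_one (2 - P).det (by rw [← Matrix.det_mul, hinv, Matrix.det_one])

/-- If `A` kills modulo `2` the vectors `v j`, `j ∈ T`, and these restrict to the standard basis
on the coordinates in `T`, then `2 ^ #T` divides `det A`. -/
theorem Matrix.two_pow_card_dvd_det {ι : Type*} [Fintype ι] [DecidableEq ι]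
    (A : Matrix ι ι ℤ) (T : Finset ι) (v : ι → ι → ℤ)
    (hv : ∀ i ∈ T, ∀ j ∈ T, v j i = if i = j then 1 else 0)
    (hA : ∀ j ∈ T, ∀ i, 2 ∣ ∑ l, A i l * v j l) : 2 ^ #T ∣ A.det := by
  refine A.two_pow_card_dvd_det_of_isUnit_det
    (Matrix.of fun i j => if j ∈ T then v j i else (1 : Matrix ι ι ℤ) i j) T
    (isUnit_det_of_eq_one_on _ T (fun i j hj => by simp [hj])
      fun i hi j hj => by simp [hj, hv i hi j hj, Matrix.one_apply]) fun i j hj => ?_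
  simpa [Matrix.mul_apply, hj] using hA j hj i

/-- The spanning subgraph whose edges join each `b` in one side of a bipartition to `σ b`. -/
def SimpleGraph.subgraphOfEquiv {V : Type*} (G : SimpleGraph V) {p : V → Prop}
    (σ : {v // p v} ≃ {v // ¬ p v}) (hσ : ∀ b : {v // p v}, G.Adj b (σ b)) : G.Subgraph where
  verts := Set.univ
  Adj v w := ∃ b : {v // p v}, (v = b ∧ w = σ b) ∨ (w = b ∧ v = σ b)
  adj_sub := by
    rintro v w ⟨b, ⟨rfl, rfl⟩ | ⟨rfl, rfl⟩⟩
    exacts [hσ b, (hσ b).symm]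
  edge_vert _ := Set.mem_univ _
  symm := ⟨fun _ _ ⟨b, h⟩ => ⟨b, h.symm⟩⟩

theorem SimpleGraph.subgraphOfEquiv_adj_iff {V : Type*} (G : SimpleGraph V) {p : V → Prop}
    (σ : {v // p v} ≃ {v // ¬ p v}) (hσ : ∀ b : {v // p v}, G.Adj b (σ b))
    (b : {v // p v}) (w : V) : (G.subgraphOfEquiv σ hσ).Adj b w ↔ w = σ b := by
  constructor
  · rintro ⟨b', ⟨h, rfl⟩ | ⟨-, h⟩⟩
    · rw [Subtype.ext h]
    · exact absurd (h ▸ b.2) (σ b').2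
  · rintro rfl
    exact ⟨b, Or.inl ⟨rfl, rfl⟩⟩

theorem SimpleGraph.subgraphOfEquiv_isPerfectMatching {V : Type*} (G : SimpleGraph V)
    {p : V → Prop} (σ : {v // p v} ≃ {v // ¬ p v}) (hσ : ∀ b : {v // p v}, G.Adj b (σ b)) :
    (G.subgraphOfEquiv σ hσ).IsPerfectMatching := by
  rw [SimpleGraph.Subgraph.isPerfectMatching_iff]
  intro v
  by_cases hv : p v
  · exact ⟨σ ⟨v, hv⟩, (G.subgraphOfEquiv_adj_iff σ hσ ⟨v, hv⟩ _).2 rfl,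
      fun w => (G.subgraphOfEquiv_adj_iff σ hσ ⟨v, hv⟩ w).1⟩
  · refine ⟨σ.symm ⟨v, hv⟩, ⟨σ.symm ⟨v, hv⟩, Or.inr ⟨rfl, by simp⟩⟩, ?_⟩
    rintro w ⟨b, ⟨rfl, -⟩ | ⟨rfl, rfl⟩⟩
    · exact absurd b.2 hv
    · simp

/-- Perfect matchings of a bipartite graph correspond to the bijections between its sides
along edges. -/
theorem matchCount_eq_card_equiv {V : Type*} (G : SimpleGraph V) (p : V → Prop)
    (hp : ∀ v w, G.Adj v w → (p v ↔ ¬ p w)) :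
    matchCount G =
      Nat.card {σ : {v // p v} ≃ {v // ¬ p v} // ∀ b : {v // p v}, G.Adj b (σ b)} := by
  symm
  refine Nat.card_congr (Equiv.ofBijective (fun σ => ⟨G.subgraphOfEquiv σ.1 σ.2,
    G.subgraphOfEquiv_isPerfectMatching σ.1 σ.2⟩) ⟨?_, ?_⟩)
  · rintro ⟨σ, hσ⟩ ⟨τ, hτ⟩ h
    have h' : G.subgraphOfEquiv σ hσ = G.subgraphOfEquiv τ hτ := congrArg Subtype.val h
    refine Subtype.ext (Equiv.ext fun b => Subtype.ext ?_)
    rw [← G.subgraphOfEquiv_adj_iff τ hτ, ← h', G.subgraphOfEquiv_adj_iff]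
  · rintro ⟨M, hM⟩
    have hM' := SimpleGraph.Subgraph.isPerfectMatching_iff.1 hM
    choose f hf hf' using hM'
    simp only at hf hf'
    have hff : ∀ v, f (f v) = v := fun v => (hf' _ _ (hf v).symm).symm
    let σ : {v // p v} ≃ {v // ¬ p v} :=
      { toFun b := ⟨f b, (hp _ _ (hf b).adj_sub).1 b.2⟩
        invFun w := ⟨f w, (hp _ _ (hf w).symm.adj_sub).2 w.2⟩
        left_inv b := Subtype.ext (hff b)
        right_inv w := Subtype.ext (hff w) }
    refine ⟨⟨σ, fun b => (hf b).adj_sub⟩, Subtype.ext (SimpleGraph.Subgraph.ext ?_ ?_)⟩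
    · exact (SimpleGraph.Subgraph.isSpanning_iff.1 hM.2).symm
    · ext v w
      constructor
      · rintro ⟨b, ⟨rfl, rfl⟩ | ⟨rfl, rfl⟩⟩
        exacts [hf b, (hf b).symm]
      · intro h
        by_cases hv : p v
        · exact ⟨⟨v, hv⟩, Or.inl ⟨rfl, hf' _ _ h⟩⟩
        · exact ⟨⟨w, by_contra fun hw => hv ((hp _ _ h.adj_sub).2 hw)⟩,
            Or.inr ⟨rfl, hf' _ _ h.symm⟩⟩

/-- `1`, `0` or `-1` according to whether `v` precedes, equals or follows `w` lexicographically. -/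
def lexSign {M N : ℕ} (v w : Fin M × Fin N) : ℤ :=
  if (v.1 : ℕ) < w.1 ∨ (v.1 : ℕ) = w.1 ∧ (v.2 : ℕ) < w.2 then 1
  else if (w.1 : ℕ) < v.1 ∨ (w.1 : ℕ) = v.1 ∧ (w.2 : ℕ) < v.2 then -1 else 0

/-- `-1` if `v`, `w` form a vertical domino and `x` lies in its lower row, strictly to its left;
`1` otherwise. -/
def leftSign {M N : ℕ} (v w x : Fin M × Fin N) : ℤ :=
  if (v.2 : ℕ) = w.2 ∧ (x.1 : ℕ) = max (v.1 : ℕ) w.1 ∧ (x.2 : ℕ) < v.2 then -1 else 1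

theorem lexSign_antisymm {M N : ℕ} (v w : Fin M × Fin N) : lexSign v w = -lexSign w v := by
  unfold lexSign
  split_ifs <;> omega

theorem leftSign_comm {M N : ℕ} (v w x : Fin M × Fin N) : leftSign v w x = leftSign w v x := by
  unfold leftSign
  congr 1
  apply propext
  omega

theorem gridGraph_adj_iff {M N : ℕ} (v w : Fin M × Fin N) : (gridGraph M N).Adj v w ↔
    (((v.1 : ℕ) = w.1 ∧ (v.2 : ℕ) + 1 = w.2 ∨ (v.2 : ℕ) = w.2 ∧ (v.1 : ℕ) + 1 = w.1) ∨
    ((w.1 : ℕ) = v.1 ∧ (w.2 : ℕ) + 1 = v.2 ∨ (w.2 : ℕ) = v.2 ∧ (w.1 : ℕ) + 1 = v.1)) := by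
  rw [gridGraph, SimpleGraph.fromRel_adj]
  simp only [Fin.ext_iff, Prod.ext_iff, ne_eq]
  omega

/-- The crossing sign of two disjoint dominoes, as arcs over the lexicographically ordered grid,
read off from which cells of one lie in the lower row and to the left of the other. -/
theorem lexSign_cross_of_lt {M N : ℕ} {v w v' w' : Fin M × Fin N}
    (h : (v.1 : ℕ) = w.1 ∧ (v.2 : ℕ) + 1 = w.2 ∨ (v.2 : ℕ) = w.2 ∧ (v.1 : ℕ) + 1 = w.1)
    (h' : (v'.1 : ℕ) = w'.1 ∧ (v'.2 : ℕ) + 1 = w'.2 ∨ (v'.2 : ℕ) = w'.2 ∧ (v'.1 : ℕ) + 1 = w'.1)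
    (hvv : v ≠ v') (hvw : v ≠ w') (hwv : w ≠ v') (hww : w ≠ w') :
    lexSign v v' * lexSign v w' * lexSign w v' * lexSign w w' =
      leftSign v' w' v * leftSign v' w' w * (leftSign v w v' * leftSign v w w') := by
  simp only [ne_eq, Prod.ext_iff, Fin.ext_iff] at hvv hvw hwv hww
  simp only [lexSign, leftSign]
  generalize (v.1 : ℕ) = a at *
  generalize (v.2 : ℕ) = b at *
  generalize (w.1 : ℕ) = c at *
  generalize (w.2 : ℕ) = d at *
  generalize (v'.1 : ℕ) = a' at *
  generalize (v'.2 : ℕ) = b' at *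
  generalize (w'.1 : ℕ) = c' at *
  generalize (w'.2 : ℕ) = d' at *
  rcases h with ⟨rfl, rfl⟩ | ⟨rfl, rfl⟩ <;> rcases h' with ⟨rfl, rfl⟩ | ⟨rfl, rfl⟩ <;>
  rcases lt_trichotomy a a' with h | rfl | h <;> rcases lt_trichotomy b b' with h2 | rfl | h2 <;>
  grind

theorem lexSign_cross {M N : ℕ} {v w v' w' : Fin M × Fin N}
    (h : (gridGraph M N).Adj v w) (h' : (gridGraph M N).Adj v' w')
    (hvv : v ≠ v') (hvw : v ≠ w') (hwv : w ≠ v') (hww : w ≠ w') :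
    lexSign v v' * lexSign v w' * lexSign w v' * lexSign w w' =
      leftSign v' w' v * leftSign v' w' w * (leftSign v w v' * leftSign v w w') := by
  rw [gridGraph_adj_iff] at h h'
  rcases h with h | h <;> rcases h' with h' | h'
  · exact lexSign_cross_of_lt h h' hvv hvw hwv hww
  · have := lexSign_cross_of_lt h h' hvw hvv hww hwv
    rw [leftSign_comm v' w', leftSign_comm v' w']
    linarith
  · have := lexSign_cross_of_lt h h' hwv hww hvv hvw
    rw [leftSign_comm v w, leftSign_comm v w]
    linarith
  · have := lexSign_cross_of_lt h h' hww hwv hvw hvv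
    rw [leftSign_comm v w, leftSign_comm v w, leftSign_comm v' w', leftSign_comm v' w']
    linarith

theorem isUnit_lexSign {M N : ℕ} {v w : Fin M × Fin N} (h : v ≠ w) : IsUnit (lexSign v w) := by
  rw [Ne, Prod.ext_iff, Fin.ext_iff, Fin.ext_iff] at h
  rw [Int.isUnit_iff, lexSign]
  split_ifs <;> omega

theorem leftSign_left {M N : ℕ} (v w : Fin M × Fin N) : leftSign v w v = 1 :=
  if_neg (by omega)

theorem leftSign_right {M N : ℕ} (v w : Fin M × Fin N) : leftSign v w w = 1 :=
  if_neg (by omega)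

/-- The sign attached to an edge of the grid: vertical edges carry the parity of their column. -/
def columnSign {M N : ℕ} (v w : Fin M × Fin N) : ℤ :=
  if (v.2 : ℕ) = w.2 then (-1) ^ (v.2 : ℕ) else 1

theorem isUnit_columnSign {M N : ℕ} (v w : Fin M × Fin N) : IsUnit (columnSign v w) := by
  unfold columnSign
  split_ifs
  exacts [isUnit_neg_one.pow _, isUnit_one]

theorem prod_leftSign {M N : ℕ} (v w : Fin M × Fin N) :
    ∏ x, leftSign v w x = columnSign v w := by
  unfold columnSign leftSign
  split_ifs with h
  · obtain ⟨r, hr⟩ : ∃ r : Fin M, (r : ℕ) = max (v.1 : ℕ) w.1 := ⟨max v.1 w.1, by simp⟩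
    simp only [h, true_and, ← hr, Fin.val_inj, Fintype.prod_prod_type]
    rw [Finset.prod_eq_single r (fun i _ hi => by simp [hi]) (by simp)]
    simp only [true_and, Finset.prod_ite, Finset.prod_const, one_pow, mul_one, Fin.val_fin_lt]
    rw [show ({x | x < w.2} : Finset (Fin N)) = Iio w.2 by ext; simp, Fin.card_Iio]
  · simp only [h, false_and, if_false, prod_const_one]

open Classical in
/-- The entries of a Kasteleyn matrix of the grid: signed adjacency. -/
noncomputable def kasteleynWeight {M N : ℕ} (v w : Fin M × Fin N) : ℤ :=
  if (gridGraph M N).Adj v w then lexSign v w * columnSign v w else 0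

theorem exists_prod_eq_sign_mul_of_antisymm {V : Type*} {c : ℕ} (f : V → V → ℤ)
    (hf : ∀ v w, f v w = -f w v) (β ω : Fin c → V) :
    ∃ C : ℤ, ∀ π : Equiv.Perm (Fin c),
      (∏ i, f (β i) (ω (π i))) * ∏ i, ∏ j ∈ Ioi i, (f (β i) (β j) * f (β i) (ω (π j)) *
        f (ω (π i)) (β j) * f (ω (π i)) (ω (π j))) = Equiv.Perm.sign π * C := by
  refine ⟨(∏ i, ∏ j ∈ Ioi i, f (β i) (β j)) * (∏ i : Fin c, ∏ j ∈ Ioi i, (-1)) *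
    (∏ j, ∏ i, f (β i) (ω j)) * ∏ i, ∏ j ∈ Ioi i, f (ω i) (ω j), fun π => ?_⟩
  have hsign := π.prod_Ioi_comp_eq_sign_mul_prod (f := fun i j => f (ω i) (ω j)) fun i j => hf _ _
  have hmixed : (∏ i, f (β i) (ω (π i))) *
      ∏ i, ∏ j ∈ Ioi i, (f (β j) (ω (π i)) * f (β i) (ω (π j))) = ∏ j, ∏ i, f (β i) (ω j) := by
    rw [prod_prod_Ioi_mul_eq_prod_prod_off_diag fun i j => f (β i) (ω (π j)),
      ← prod_mul_distrib, ← Equiv.prod_comp π fun j => ∏ i, f (β i) (ω j)]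
    exact prod_congr rfl fun i _ =>
      (Fintype.prod_eq_mul_prod_compl i fun j => f (β j) (ω (π i))).symm
  have hterm : ∀ i j, f (β i) (β j) * f (β i) (ω (π j)) * f (ω (π i)) (β j) *
      f (ω (π i)) (ω (π j)) = f (β i) (β j) * -1 *
        (f (β j) (ω (π i)) * f (β i) (ω (π j))) * f (ω (π i)) (ω (π j)) := by
    intro i j
    rw [hf (ω (π i)) (β j)]
    ring
  simp only [Int.cast_id] at hsign
  simp only [hterm]
  rw [← hmixed]
  simp only [prod_mul_distrib]
  rw [hsign]
  ring

/-- The cells of one colour of the checkerboard. -/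
abbrev IsBlack {M N : ℕ} (v : Fin M × Fin N) : Prop := Even ((v.1 : ℕ) + v.2)

theorem prod_kasteleynWeight {M N c : ℕ} (β : Fin c ≃ {v : Fin M × Fin N // IsBlack v})
    (ω : Fin c ≃ {v : Fin M × Fin N // ¬ IsBlack v}) (π : Equiv.Perm (Fin c))
    (hπ : ∀ i, (gridGraph M N).Adj (β i) (ω (π i))) :
    ∏ i, kasteleynWeight (β i : Fin M × Fin N) (ω (π i)) =
      (∏ i, lexSign (β i : Fin M × Fin N) (ω (π i))) *
        ∏ i, ∏ j ∈ Ioi i, (lexSign (β i : Fin M × Fin N) (β j) *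
          lexSign (β i : Fin M × Fin N) (ω (π j)) *
          lexSign (ω (π i) : Fin M × Fin N) (β j) *
          lexSign (ω (π i) : Fin M × Fin N) (ω (π j))) := by
  classical
  have hne : ∀ i j, (β i : Fin M × Fin N) ≠ ω j := fun i j h => (ω j).2 (h ▸ (β i).2)
  simp only [kasteleynWeight, hπ, if_true, prod_mul_distrib (f := fun i => lexSign _ _)
    (g := fun i => columnSign _ _)]
  congr 1
  have hcross : ∀ i, ∀ j ∈ Ioi i, lexSign (β i : Fin M × Fin N) (β j) *
      lexSign (β i : Fin M × Fin N) (ω (π j)) * lexSign (ω (π i) : Fin M × Fin N) (β j) *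
      lexSign (ω (π i) : Fin M × Fin N) (ω (π j)) =
      leftSign (β j : Fin M × Fin N) (ω (π j)) (β i) *
        leftSign (β j : Fin M × Fin N) (ω (π j)) (ω (π i)) *
      (leftSign (β i : Fin M × Fin N) (ω (π i)) (β j) *
        leftSign (β i : Fin M × Fin N) (ω (π i)) (ω (π j))) := by
    intro i j hij
    have hij := (mem_Ioi.1 hij).ne
    exact lexSign_cross (hπ i) (hπ j) (fun h => hij (β.injective (Subtype.ext h))) (hne _ _)
      (hne _ _).symm fun h => hij (π.injective (ω.injective (Subtype.ext h)))
  rw [prod_congr rfl fun i _ => prod_congr rfl (hcross i),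
    prod_prod_Ioi_mul_eq_prod_prod_off_diag fun j i =>
      leftSign (β j : Fin M × Fin N) (ω (π j)) (β i) *
        leftSign (β j : Fin M × Fin N) (ω (π j)) (ω (π i))]
  have hdiag : ∀ i, ∏ j ∈ {i}ᶜ, leftSign (β j : Fin M × Fin N) (ω (π j)) (β i) *
      leftSign (β j : Fin M × Fin N) (ω (π j)) (ω (π i)) =
      ∏ j, leftSign (β j : Fin M × Fin N) (ω (π j)) (β i) *
        leftSign (β j : Fin M × Fin N) (ω (π j)) (ω (π i)) := fun i => by
    rw [Fintype.prod_eq_mul_prod_compl i, leftSign_left, leftSign_right, one_mul, one_mul]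
  simp only [hdiag]
  rw [prod_comm]
  refine prod_congr rfl fun j _ => ?_
  rw [← prod_leftSign, prod_mul_distrib,
    ← Fintype.prod_subtype_mul_prod_subtype IsBlack,
    ← β.prod_comp, ← (π.trans ω).prod_comp]
  rfl

/-- Kasteleyn's theorem for the grid. -/
theorem natAbs_det_kasteleyn {M N c : ℕ} (β : Fin c ≃ {v : Fin M × Fin N // IsBlack v})
    (ω : Fin c ≃ {v : Fin M × Fin N // ¬ IsBlack v}) :
    (Matrix.of fun i j => kasteleynWeight (β i : Fin M × Fin N) (ω j)).det.natAbs =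
      Nat.card {π : Equiv.Perm (Fin c) // ∀ i, (gridGraph M N).Adj (β i) (ω (π i))} := by
  classical
  obtain ⟨C, hC⟩ := exists_prod_eq_sign_mul_of_antisymm lexSign lexSign_antisymm
    (fun i => (β i : Fin M × Fin N)) fun i => (ω i : Fin M × Fin N)
  have hsq : ∀ π : Equiv.Perm (Fin c), ((Equiv.Perm.sign π : ℤ)) * Equiv.Perm.sign π = 1 :=
    fun π => Int.units_coe_mul_self _
  have hterm : ∀ π : Equiv.Perm (Fin c),
      (Equiv.Perm.sign π : ℤ) * ∏ i, kasteleynWeight (β i : Fin M × Fin N) (ω (π i)) =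
        if ∀ i, (gridGraph M N).Adj (β i) (ω (π i)) then C else 0 := by
    intro π
    split_ifs with h
    · rw [prod_kasteleynWeight β ω π h, hC, ← mul_assoc, hsq, one_mul]
    · obtain ⟨i, hi⟩ := not_forall.1 h
      rw [prod_eq_zero (mem_univ i) (if_neg hi), mul_zero]
  rw [← Matrix.det_transpose, Matrix.det_apply']
  simp only [Matrix.transpose_apply, Matrix.of_apply, Int.cast_id, hterm]
  rw [← sum_filter, sum_const, nsmul_eq_mul, Int.natAbs_mul, Int.natAbs_natCast,
    Nat.card_eq_fintype_card, Fintype.card_subtype]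
  rcases (univ.filter fun π : Equiv.Perm (Fin c) =>
    ∀ i, (gridGraph M N).Adj (β i) (ω (π i))).eq_empty_or_nonempty with h | ⟨π, hπ⟩
  · rw [h, card_empty, zero_mul]
  · have hπ := (mem_filter.1 hπ).2
    have hunit : IsUnit C := by
      have hC := hterm π
      rw [if_pos hπ] at hC
      rw [← hC]
      refine (Equiv.Perm.sign π).isUnit.mul (IsUnit.prod_iff.2 fun i _ => ?_)
      rw [kasteleynWeight, if_pos (hπ i)]
      exact (isUnit_lexSign (hπ i).ne).mul (isUnit_columnSign _ _)
    rw [Int.isUnit_iff_natAbs_eq.1 hunit, mul_one]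

theorem gridGraph_adj_isBlack {M N : ℕ} (v w : Fin M × Fin N) (h : (gridGraph M N).Adj v w) :
    IsBlack v ↔ ¬ IsBlack w := by
  rw [gridGraph_adj_iff] at h
  simp only [IsBlack, Nat.even_iff]
  omega

theorem kasteleynWeight_cast_zmod_two {M N : ℕ} (v w : Fin M × Fin N)
    [Decidable ((gridGraph M N).Adj v w)] :
    (kasteleynWeight v w : ZMod 2) = if (gridGraph M N).Adj v w then 1 else 0 := by
  unfold kasteleynWeight
  split_ifs with h
  · rcases Int.isUnit_iff.1 ((isUnit_lexSign h.ne).mul (isUnit_columnSign v w)) with h | h <;>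
      rw [h] <;> decide
  · simp

theorem sum_ite_coord_eq {R : Type*} [AddCommMonoid R] {M N : ℕ} (F : ℤ → ℤ → R)
    (hrow : ∀ y, F 0 y = 0 ∧ F (M + 1) y = 0) (hcol : ∀ x, F x 0 = 0 ∧ F x (N + 1) = 0)
    {a b : ℤ} (ha : 0 ≤ a ∧ a ≤ M + 1) (hb : 0 ≤ b ∧ b ≤ N + 1) :
    ∑ w : Fin M × Fin N, (if (w.1 : ℤ) + 1 = a ∧ (w.2 : ℤ) + 1 = b
      then F (w.1 + 1) (w.2 + 1) else 0) = F a b := by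
  by_cases hab : 0 < a ∧ a < M + 1 ∧ 0 < b ∧ b < N + 1
  · rw [sum_eq_single
      (⟨⟨(a - 1).toNat, by omega⟩, ⟨(b - 1).toNat, by omega⟩⟩ : Fin M × Fin N)]
    · have h1 : ((a - 1).toNat : ℤ) + 1 = a := by omega
      have h2 : ((b - 1).toNat : ℤ) + 1 = b := by omega
      simp only [h1, h2, and_self, if_true]
    · intro w _ hw
      refine if_neg fun h => hw (Prod.ext (Fin.ext ?_) (Fin.ext ?_)) <;> dsimp only <;> omega
    · simp
  · have hF : F a b = 0 := by
      rcases (by omega : a = 0 ∨ a = M + 1 ∨ b = 0 ∨ b = N + 1) with rfl | rfl | rfl | rfl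
      exacts [(hrow _).1, (hrow _).2, (hcol _).1, (hcol _).2]
    rw [hF]
    exact sum_eq_zero fun w _ => if_neg fun h => hab (by omega)

theorem sum_gridGraph_adj {R : Type*} [AddCommMonoid R] {M N : ℕ} (F : ℤ → ℤ → R)
    (hrow : ∀ y, F 0 y = 0 ∧ F (M + 1) y = 0) (hcol : ∀ x, F x 0 = 0 ∧ F x (N + 1) = 0)
    (v : Fin M × Fin N) [DecidablePred ((gridGraph M N).Adj v)] :
    ∑ w, (if (gridGraph M N).Adj v w then F (w.1 + 1) (w.2 + 1) else 0) =
      F (v.1 + 1) (v.2 + 2) + F (v.1 + 2) (v.2 + 1) + F (v.1 + 1) v.2 + F v.1 (v.2 + 1) := by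
  rw [← sum_ite_coord_eq F hrow hcol (a := v.1 + 1) (b := v.2 + 2) (by omega) (by omega),
    ← sum_ite_coord_eq F hrow hcol (a := v.1 + 2) (b := v.2 + 1) (by omega) (by omega),
    ← sum_ite_coord_eq F hrow hcol (a := v.1 + 1) (b := v.2) (by omega) (by omega),
    ← sum_ite_coord_eq F hrow hcol (a := v.1) (b := v.2 + 1) (by omega) (by omega)]
  simp only [← sum_add_distrib]
  refine sum_congr rfl fun w _ => ?_
  simp only [gridGraph_adj_iff]
  split_ifs <;> first | omega | simp

open Classical in
/-- The indicator of the odd integers at distance more than `2 * t` from all multiples of `2 * d`: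
an even, `2 * d`-periodic function. -/
noncomputable def oddBump (d t : ℕ) (u : ℤ) : ℤ :=
  if Odd u ∧ ∀ k : ℤ, 2 * (t : ℤ) < |u - 2 * d * k| then 1 else 0

theorem oddBump_add_mul (d t : ℕ) (u l : ℤ) : oddBump d t (u + 2 * d * l) = oddBump d t u := by
  unfold oddBump
  congr 1
  refine propext (and_congr (by simp [parity_simps, mul_assoc]) ⟨fun h k => ?_, fun h k => ?_⟩)
  · convert h (k + l) using 2
    ring
  · convert h (k - l) using 2
    ring

theorem oddBump_neg (d t : ℕ) (u : ℤ) : oddBump d t (-u) = oddBump d t u := by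
  unfold oddBump
  congr 1
  refine propext (and_congr (by simp [parity_simps]) ⟨fun h k => ?_, fun h k => ?_⟩)
  · convert h (-k) using 1
    rw [← abs_neg]
    ring_nf
  · convert h (-k) using 1
    rw [← abs_neg]
    ring_nf

theorem oddBump_of_odd {d : ℕ} (t : ℕ) {u : ℤ} (hu : Odd u) (h0 : 0 ≤ u) (hd : u ≤ d) :
    oddBump d t u = if 2 * (t : ℤ) < u then 1 else 0 := by
  unfold oddBump
  congr 1
  refine propext ⟨fun h => ?_, fun h => ⟨hu, fun k => h.trans_le ?_⟩⟩
  · simpa [abs_of_nonneg h0] using h.2 0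
  · rcases le_or_gt k 0 with hk | hk
    · exact le_trans (by nlinarith) (le_abs_self _)
    · exact le_trans (by nlinarith) (neg_le_abs _)

/-- A function on `ℤ × ℤ` that vanishes on the lines `x ∈ d ℤ` and `y ∈ d ℤ` and whose sums over
the four neighbours of a point are even. -/
noncomputable def diagonalWave (d t : ℕ) (x y : ℤ) : ℤ :=
  oddBump d t (x + y) - oddBump d t (x - y)

theorem diagonalWave_mul_left (d t : ℕ) (l y : ℤ) : diagonalWave d t (d * l) y = 0 := by
  rw [diagonalWave, sub_eq_zero, ← oddBump_neg, ← oddBump_add_mul d t _ l]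
  congr 1
  ring

theorem diagonalWave_mul_right (d t : ℕ) (x l : ℤ) : diagonalWave d t x (d * l) = 0 := by
  rw [diagonalWave, sub_eq_zero, ← oddBump_add_mul d t (x - d * l) l]
  congr 1
  ring

theorem diagonalWave_one {d : ℕ} (t : ℕ) {s : ℕ} (hs : 0 < s) (hd : 2 * s + 1 ≤ d) :
    diagonalWave d t 1 (2 * s) = if s = t then 1 else 0 := by
  rw [diagonalWave, ← oddBump_neg d t (1 - 2 * s),
    oddBump_of_odd t ⟨s, by ring⟩ (by omega) (by omega),
    oddBump_of_odd t ⟨s - 1, by ring⟩ (by omega) (by omega)]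
  split_ifs <;> omega

theorem two_dvd_sum_kasteleynWeight_mul_diagonalWave {m n d t : ℕ}
    (hm : d ∣ m + 1) (hn : d ∣ n + 1) (b : Fin m × Fin n) (hb : IsBlack b) :
    2 ∣ ∑ w : {v : Fin m × Fin n // ¬ IsBlack v},
      kasteleynWeight b w *
        diagonalWave d t ((w : Fin m × Fin n).1 + 1) ((w : Fin m × Fin n).2 + 1) := by
  classical
  obtain ⟨k, hk⟩ := hm
  obtain ⟨l, hl⟩ := hn
  zify at hk hl
  refine (ZMod.intCast_zmod_eq_zero_iff_dvd _ 2).1 ?_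
  push_cast
  have hblack : ∑ w : {v : Fin m × Fin n // IsBlack v}, (kasteleynWeight b w : ZMod 2) *
      diagonalWave d t ((w : Fin m × Fin n).1 + 1) ((w : Fin m × Fin n).2 + 1) = 0 :=
    sum_eq_zero fun w _ => by
      rw [kasteleynWeight_cast_zmod_two, if_neg fun h => (gridGraph_adj_isBlack _ _ h).1 hb w.2,
        zero_mul]
  have hsplit := Fintype.sum_subtype_add_sum_subtype IsBlack fun w =>
    (kasteleynWeight b w : ZMod 2) * diagonalWave d t (w.1 + 1) (w.2 + 1)
  rw [hblack, zero_add] at hsplit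
  rw [hsplit]
  simp only [kasteleynWeight_cast_zmod_two, ite_mul, one_mul, zero_mul]
  rw [sum_gridGraph_adj (fun x y => (diagonalWave d t x y : ZMod 2))]
  · have h2 : (2 : ZMod 2) = 0 := rfl
    simp only [diagonalWave]
    push_cast
    ring_nf
    simp [h2]
  · intro y
    rw [hk, diagonalWave_mul_left, ← mul_zero (d : ℤ), diagonalWave_mul_left]
    simp
  · intro y
    rw [hl, diagonalWave_mul_right, ← mul_zero (d : ℤ), diagonalWave_mul_right]
    simp

theorem two_pow_dvd_det_kasteleyn {M N c d : ℕ} (hM : d ∣ M + 1) (hN : d ∣ N + 1)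
    (β : Fin c ≃ {v : Fin M × Fin N // IsBlack v})
    (ω : Fin c ≃ {v : Fin M × Fin N // ¬ IsBlack v}) :
    2 ^ ((d - 1) / 2) ∣
      (Matrix.of fun i j => kasteleynWeight (β i : Fin M × Fin N) (ω j)).det := by
  let row (j : Fin c) : ℕ := (ω j : Fin M × Fin N).1
  let col (j : Fin c) : ℕ := (ω j : Fin M × Fin N).2
  let T : Finset (Fin c) := {j | row j = 0 ∧ col j + 2 ≤ d}
  have hT : ∀ j ∈ T, row j = 0 ∧ ∃ s, 0 < s ∧ 2 * s + 1 ≤ d ∧ col j + 1 = 2 * s := by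
    intro j hj
    obtain ⟨hrow, hcol⟩ := (mem_filter.1 hj).2
    have hodd : ¬ Even (row j + col j) := (ω j).2
    rw [Nat.even_iff] at hodd
    exact ⟨hrow, (col j + 1) / 2, by omega, by omega, by omega⟩
  have hinj : ∀ i j, row i = row j → col i = col j → i = j := fun i j hr hc =>
    ω.injective (Subtype.ext (Prod.ext (Fin.ext hr) (Fin.ext hc)))
  have hcard : (d - 1) / 2 ≤ #T := by
    have hdM := Nat.le_of_dvd M.succ_pos hM
    have hdN := Nat.le_of_dvd N.succ_pos hN
    let τ (t : Fin ((d - 1) / 2)) : Fin c :=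
      ω.symm ⟨(⟨0, by have := t.2; omega⟩, ⟨2 * t + 1, by have := t.2; omega⟩),
        by simp [IsBlack, parity_simps]⟩
    have hτ : Function.Injective τ := by
      intro s t h
      have h' := congrArg (fun w : {v : Fin M × Fin N // ¬ IsBlack v} => (w.1.2 : ℕ))
        (ω.symm.injective h)
      simp only at h'
      omega
    rw [← Fintype.card_fin ((d - 1) / 2), ← card_univ, ← card_image_of_injective _ hτ]
    refine card_le_card (image_subset_iff.2 fun t _ => mem_filter.2 ⟨mem_univ _, ?_⟩)
    have ht := t.2
    simp only [row, col, τ, Equiv.apply_symm_apply, true_and]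
    omega
  refine (pow_dvd_pow 2 hcard).trans (Matrix.two_pow_card_dvd_det _ T
    (fun j i => diagonalWave d ((col j + 1) / 2) (row i + 1) (col i + 1)) ?_ fun j _ i => ?_)
  · intro i hi j hj
    obtain ⟨hri, s, hs, hsd, hsc⟩ := hT i hi
    obtain ⟨hrj, t, -, -, htc⟩ := hT j hj
    have hy : ((col i : ℤ) + 1) = 2 * s := by omega
    rw [hy, hri, htc, Nat.mul_div_cancel_left t two_pos, Nat.cast_zero, zero_add,
      diagonalWave_one t hs hsd]
    refine if_congr ⟨fun h => hinj i j (by omega) (by omega), ?_⟩ rfl rfl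
    rintro rfl
    omega
  · have h := two_dvd_sum_kasteleynWeight_mul_diagonalWave (t := (col j + 1) / 2) hM hN
      (β i) (β i).2
    rwa [← ω.sum_comp] at h

/-- The number of perfect matchings of `R_{(m−1)×(n−1)}` is divisible by
`2^{⌊(gcd(m,n)−1)/2⌋}`. -/
theorem grid_matchCount_two_divisibility (m n : ℕ) (hm : 1 ≤ m) (hn : 1 ≤ n) :
    2 ^ ((Nat.gcd m n - 1) / 2) ∣ matchCount (gridGraph (m - 1) (n - 1)) := by
  rw [matchCount_eq_card_equiv _ IsBlack gridGraph_adj_isBlack]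
  rcases isEmpty_or_nonempty ({v : Fin (m - 1) × Fin (n - 1) // IsBlack v} ≃
    {v : Fin (m - 1) × Fin (n - 1) // ¬ IsBlack v}) with _ | ⟨⟨e⟩⟩
  · rw [Nat.card_of_isEmpty]
    exact dvd_zero _
  · let β := (Fintype.equivFin {v : Fin (m - 1) × Fin (n - 1) // IsBlack v}).symm
    have hcard := Nat.card_congr ((Equiv.equivCongr β (β.trans e)).subtypeEquiv
      (p := fun π : Equiv.Perm _ =>
        ∀ i, (gridGraph (m - 1) (n - 1)).Adj (β i) ((β.trans e) (π i)))
      (q := fun σ => ∀ b : {v : Fin (m - 1) × Fin (n - 1) // IsBlack v},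
        (gridGraph (m - 1) (n - 1)).Adj b (σ b))
      fun π => ⟨fun h b => by simpa using h (β.symm b), fun h i => by simpa using h (β i)⟩)
    rw [← hcard, ← natAbs_det_kasteleyn β (β.trans e), ← Int.natCast_dvd, Nat.cast_pow,
      Nat.cast_ofNat]
    refine two_pow_dvd_det_kasteleyn ?_ ?_ β (β.trans e)
    · rw [Nat.sub_add_cancel hm]
      exact Nat.gcd_dvd_left m n
    · rw [Nat.sub_add_cancel hn]
      exact Nat.gcd_dvd_right m n
end

section
/- Let m, n ≥ 1 be integers such that (m−1)(n−1) is even. Color the vertex (i,j) of the grid graph R_{(m−1)×(n−1)} black if i+j is even and white otherwise. Then the number of channels of R_{(m−1)×(n−1)} consisting only of black vertices equals 2^{(gcd(m,n)−1)/2} (note gcd(m,n) is odd under the hypothesis, so the exponent is an exact natural number). -/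
/-- The distance from `k` to the nearest multiple of `M`. -/
def foldDist (M : ℕ) (k : ℤ) : ℤ := |Int.bmod k M|

theorem foldDist_nonneg (M : ℕ) (k : ℤ) : 0 ≤ foldDist M k := abs_nonneg _

theorem two_mul_foldDist_le {M : ℕ} (hM : 0 < M) (k : ℤ) : 2 * foldDist M k ≤ M := by
  have h₁ := Int.le_bmod (x := k) hM
  have h₂ := Int.bmod_le (x := k) hM
  unfold foldDist
  rcases abs_cases (Int.bmod k M) with h | h <;> omega

theorem exists_eq_foldDist (M : ℕ) (k : ℤ) :
    ∃ t : ℤ, k = foldDist M k + M * t ∨ k = -foldDist M k + M * t := by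
  refine ⟨Int.bdiv k M, ?_⟩
  have h := Int.bmod_add_bdiv k M
  unfold foldDist
  rcases abs_cases (Int.bmod k M) with h' | h'
  · left; rw [h'.1, h]
  · right; rw [h'.1, neg_neg, h]

theorem foldDist_add_mul (M : ℕ) (k t : ℤ) : foldDist M (k + M * t) = foldDist M k := by
  simp [foldDist]

theorem foldDist_of_two_mul_le {M : ℕ} {r : ℤ} (h₀ : 0 ≤ r) (h : 2 * r ≤ M) :
    foldDist M r = r := by
  unfold foldDist
  rcases h₀.eq_or_lt with rfl | hr
  · simp
  rcases h.lt_or_eq with h | h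
  · rw [Int.bmod_eq_of_le_mul_two (by omega) (by omega), abs_of_nonneg h₀]
  · have : Int.bmod r M = -r := by
      have hs := Int.add_bmod_right (-r) M
      rw [show -r + M = r by omega] at hs
      rw [hs, Int.bmod_eq_of_le_mul_two (by omega) (by omega)]
    rw [this, abs_neg, abs_of_nonneg h₀]

theorem foldDist_neg (M : ℕ) (k : ℤ) : foldDist M (-k) = foldDist M k := by
  rcases Nat.eq_zero_or_pos M with rfl | hM
  · simp [foldDist]
  have h₀ := foldDist_nonneg M k
  have hle := two_mul_foldDist_le hM k
  have key : foldDist M (-foldDist M k) = foldDist M k := by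
    rcases hle.lt_or_eq with h | h
    · change |Int.bmod (-foldDist M k) M| = _
      rw [Int.bmod_eq_of_le_mul_two (by omega) (by omega), abs_neg, abs_of_nonneg h₀]
    · have := foldDist_add_mul M (-foldDist M k) 1
      rw [← this, show -foldDist M k + M * 1 = foldDist M k by omega]
      exact foldDist_of_two_mul_le h₀ hle
  obtain ⟨t, ht | ht⟩ := exists_eq_foldDist M k
  · have : -k = -foldDist M k + M * (-t) := by linear_combination -ht
    rw [this, foldDist_add_mul, key]
  · have : -k = foldDist M k + M * (-t) := by linear_combination -ht
    rw [this, foldDist_add_mul, foldDist_of_two_mul_le h₀ hle]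

/-- An even function of period `M` factors through `foldDist M`. -/
theorem apply_foldDist {α : Type*} {M : ℕ} {a : ℤ → α} (ha : ∀ k, a (-k) = a k)
    (hp : Function.Periodic a M) (k : ℤ) : a (foldDist M k) = a k := by
  obtain ⟨t, ht | ht⟩ := exists_eq_foldDist M k
  · have := hp.int_mul t (foldDist M k)
    rw [mul_comm] at this
    rw [← this, Int.cast_id, ← ht]
  · have := hp.int_mul t (-foldDist M k)
    rw [mul_comm] at this
    rw [← ha, ← this, Int.cast_id, ← ht]

theorem foldDist_neighbors_interior {m : ℕ} {i : ℤ} (u : ℤ → ZMod 2)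
    (h₀ : 0 < foldDist (2 * m) i) (h₁ : foldDist (2 * m) i < m) :
    u (foldDist (2 * m) (i - 1)) + u (foldDist (2 * m) (i + 1)) =
      u (foldDist (2 * m) i - 1) + u (foldDist (2 * m) i + 1) := by
  have hs : foldDist (2 * m) (foldDist (2 * m) i - 1) = foldDist (2 * m) i - 1 :=
    foldDist_of_two_mul_le (by omega) (by push_cast; omega)
  have hs' : foldDist (2 * m) (foldDist (2 * m) i + 1) = foldDist (2 * m) i + 1 :=
    foldDist_of_two_mul_le (by omega) (by push_cast; omega)
  obtain ⟨t, ht | ht⟩ := exists_eq_foldDist (2 * m) i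
  · generalize foldDist (2 * m) i = r at *
    subst ht
    rw [show r + ((2 * m : ℕ) : ℤ) * t - 1 = r - 1 + ((2 * m : ℕ) : ℤ) * t by ring,
      show r + ((2 * m : ℕ) : ℤ) * t + 1 = r + 1 + ((2 * m : ℕ) : ℤ) * t by ring,
      foldDist_add_mul, foldDist_add_mul, hs, hs']
  · generalize foldDist (2 * m) i = r at *
    subst ht
    rw [show -r + ((2 * m : ℕ) : ℤ) * t - 1 = -(r + 1) + ((2 * m : ℕ) : ℤ) * t by ring,
      show -r + ((2 * m : ℕ) : ℤ) * t + 1 = -(r - 1) + ((2 * m : ℕ) : ℤ) * t by ring,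
      foldDist_add_mul, foldDist_add_mul, foldDist_neg, foldDist_neg, hs, hs', add_comm]

theorem foldDist_neighbors_boundary {m : ℕ} {i : ℤ}
    (h : foldDist (2 * m) i = 0 ∨ foldDist (2 * m) i = m) :
    foldDist (2 * m) (i - 1) = foldDist (2 * m) (i + 1) := by
  have key : ∃ s : ℤ, i = -i + ((2 * m : ℕ) : ℤ) * s := by
    obtain ⟨t, ht⟩ := exists_eq_foldDist (2 * m) i
    push_cast at *
    rcases h with h | h <;> rw [h] at ht <;> rcases ht with ht | ht
    · exact ⟨2 * t, by linear_combination 2 * ht⟩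
    · exact ⟨2 * t, by linear_combination 2 * ht⟩
    · exact ⟨2 * t + 1, by linear_combination 2 * ht⟩
    · exact ⟨2 * t - 1, by linear_combination 2 * ht⟩
  obtain ⟨s, hs⟩ := key
  rw [show i - 1 = -(i + 1) + ((2 * m : ℕ) : ℤ) * s by linear_combination hs,
    foldDist_add_mul, foldDist_neg]

/-- The part of `C` at the point `(i, j)`, in coordinates starting from `1`. -/
def cell {p q : ℕ} (C : Set (Fin p × Fin q)) (i j : ℤ) : Set (Fin p × Fin q) :=
  {w | w ∈ C ∧ (w.1 : ℤ) + 1 = i ∧ (w.2 : ℤ) + 1 = j}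

/-- The indicator function of `C`, extended by zero, in coordinates starting from `1`. -/
noncomputable def ind {p q : ℕ} (C : Set (Fin p × Fin q)) (i j : ℤ) : ZMod 2 :=
  ((cell C i j).ncard : ZMod 2)

theorem ind_of_mem {p q : ℕ} {C : Set (Fin p × Fin q)} {v : Fin p × Fin q} (hv : v ∈ C) :
    ind C (v.1 + 1) (v.2 + 1) = 1 := by
  have : cell C (v.1 + 1) (v.2 + 1) = {v} := by
    ext w
    simp only [cell, Set.mem_ofPred_eq, Set.mem_singleton_iff, Prod.ext_iff, Fin.ext_iff]
    constructor
    · omega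
    · intro h
      refine ⟨?_, by omega, by omega⟩
      rwa [show w = v from Prod.ext (Fin.ext h.1) (Fin.ext h.2)]
  simp [ind, this]

theorem ind_of_forall_notMem {p q : ℕ} {C : Set (Fin p × Fin q)} {i j : ℤ}
    (h : ∀ w ∈ C, (w.1 : ℤ) + 1 = i → (w.2 : ℤ) + 1 ≠ j) : ind C i j = 0 := by
  have : cell C i j = ∅ := by
    ext w
    simp only [cell, Set.mem_ofPred_eq, Set.mem_empty_iff_false, iff_false]
    exact fun hw => h w hw.1 hw.2.1 hw.2.2
  simp [ind, this]

theorem mem_iff_ind {p q : ℕ} {C : Set (Fin p × Fin q)} {v : Fin p × Fin q} :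
    v ∈ C ↔ ind C (v.1 + 1) (v.2 + 1) = 1 := by
  refine ⟨ind_of_mem, fun h => ?_⟩
  by_contra hv
  rw [ind_of_forall_notMem] at h
  · exact absurd h (by decide)
  · intro w hw h₁ h₂
    apply hv
    rwa [show v = w from Prod.ext (Fin.ext (by omega)) (Fin.ext (by omega))]

theorem ind_outside {p q : ℕ} {C : Set (Fin p × Fin q)} {i j : ℤ}
    (h : i ≤ 0 ∨ (p : ℤ) < i ∨ j ≤ 0 ∨ (q : ℤ) < j) : ind C i j = 0 := by
  apply ind_of_forall_notMem
  intro w _ h₁ h₂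
  have := w.1.isLt
  have := w.2.isLt
  omega

theorem neighbors_eq_union_cell {p q : ℕ} (C : Set (Fin p × Fin q)) (v : Fin p × Fin q) :
    {w | w ∈ C ∧ (gridGraph p q).Adj v w} =
      (cell C v.1 (v.2 + 1) ∪ cell C (v.1 + 2) (v.2 + 1)) ∪
        (cell C (v.1 + 1) v.2 ∪ cell C (v.1 + 1) (v.2 + 2)) := by
  ext w
  simp only [gridGraph, SimpleGraph.fromRel_adj, cell, Set.mem_union, Set.mem_ofPred_eq, ne_eq,
    Prod.ext_iff, Fin.ext_iff]
  constructor
  · rintro ⟨hw, _, h⟩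
    simp only [hw, true_and]
    omega
  · intro h
    have hw : w ∈ C := by tauto
    simp only [hw, true_and] at h ⊢
    omega

theorem disjoint_cell {p q : ℕ} (C : Set (Fin p × Fin q)) {i j i' j' : ℤ}
    (h : i ≠ i' ∨ j ≠ j') : Disjoint (cell C i j) (cell C i' j') := by
  rw [Set.disjoint_left]
  rintro w ⟨-, h₁, h₂⟩ ⟨-, h₃, h₄⟩
  omega

theorem isChannel_iff_ind {p q : ℕ} (C : Set (Fin p × Fin q)) :
    IsChannel (gridGraph p q) C ↔ ∀ v : Fin p × Fin q,
      ind C v.1 (v.2 + 1) + ind C (v.1 + 2) (v.2 + 1) +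
        (ind C (v.1 + 1) v.2 + ind C (v.1 + 1) (v.2 + 2)) = 0 := by
  refine forall_congr' fun v => ?_
  rw [neighbors_eq_union_cell, ← ZMod.natCast_eq_zero_iff_even, Set.ncard_union_eq,
    Set.ncard_union_eq, Set.ncard_union_eq]
  · simp only [Nat.cast_add, ind]
  · exact disjoint_cell C (by omega)
  · exact disjoint_cell C (by omega)
  · simp only [Set.disjoint_union_left, Set.disjoint_union_right]
    exact ⟨⟨disjoint_cell C (by omega), disjoint_cell C (by omega)⟩,
      disjoint_cell C (by omega), disjoint_cell C (by omega)⟩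

/-- D'Alembert's formula for the discrete wave equation modulo `2`, in characteristic
coordinates. -/
theorem eq_add_of_wave {G : ℤ → ℤ → ZMod 2}
    (hw : ∀ p q, G (p + 1) (q + 1) + G p q + (G (p + 1) q + G p (q + 1)) = 0)
    (hd : ∀ p, G p p = 0) (p q : ℤ) : G p q = G p 0 + G q 0 := by
  have arith : ∀ a b c d : ZMod 2, a + b + (c + d) = 0 → a + d = c + b := by decide
  have hcol : ∀ p q, G (p + 1) q + G p q = G (p + 1) 0 + G p 0 := by
    intro p q
    induction q using Int.induction_on with
    | zero => rfl
    | succ k ih => rw [← ih]; exact arith _ _ _ _ (hw p k)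
    | pred k ih =>
      rw [← ih]
      have := hw p (-(k : ℤ) - 1)
      rw [sub_add_cancel] at this
      exact (arith _ _ _ _ this).symm
  have split : ∀ p q, G p q = G p 0 + G 0 q := by
    intro p q
    have arith₁ : ∀ a b c d e : ZMod 2, a + b = c + d → b = d + e → a = c + e := by decide
    have arith₂ : ∀ a b c d e : ZMod 2, a + b = c + d → a = c + e → b = d + e := by decide
    induction p using Int.induction_on with
    | zero => rw [hd 0, zero_add]
    | succ k ih => exact arith₁ _ _ _ _ _ (hcol k q) ih
    | pred k ih =>
      have := hcol (-(k : ℤ) - 1) q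
      rw [sub_add_cancel] at this
      exact arith₂ _ _ _ _ _ this ih
  have hq : G 0 q = G q 0 := by
    have := split q q
    rw [hd] at this
    exact (CharTwo.add_eq_zero.mp this.symm).symm
  rw [split, hq]

/-- The solution of the wave equation on the black points with profile `a`. -/
def wave (a : ℤ → ZMod 2) (i j : ℤ) : ZMod 2 :=
  if Even (i + j) then a ((i + j) / 2) + a ((j - i) / 2) else 0

theorem wave_eq (a : ℤ → ZMod 2) (i j : ℤ) :
    wave a i (j + 1) + wave a (i + 2) (j + 1) +
      (wave a (i + 1) j + wave a (i + 1) (j + 2)) = 0 := by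
  unfold wave
  by_cases h : Even (i + j)
  · have h₁ : ¬ Even (i + (j + 1)) := by grind
    have h₂ : ¬ Even (i + 2 + (j + 1)) := by grind
    have h₃ : ¬ Even (i + 1 + j) := by grind
    have h₄ : ¬ Even (i + 1 + (j + 2)) := by grind
    simp [h₁, h₂, h₃, h₄]
  · obtain ⟨c, hc⟩ := Int.not_even_iff_odd.mp h
    have h₁ : Even (i + (j + 1)) := ⟨c + 1, by omega⟩
    have h₂ : Even (i + 2 + (j + 1)) := ⟨c + 2, by omega⟩
    have h₃ : Even (i + 1 + j) := ⟨c + 1, by omega⟩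
    have h₄ : Even (i + 1 + (j + 2)) := ⟨c + 2, by omega⟩
    simp only [h₁, h₂, h₃, h₄, if_true]
    rw [show (i + (j + 1)) / 2 = c + 1 by omega, show (j + 1 - i) / 2 = c + 1 - i by omega,
      show (i + 2 + (j + 1)) / 2 = c + 2 by omega, show (j + 1 - (i + 2)) / 2 = c - i by omega,
      show (i + 1 + j) / 2 = c + 1 by omega, show (j - (i + 1)) / 2 = c - i by omega,
      show (i + 1 + (j + 2)) / 2 = c + 2 by omega,
      show (j + 2 - (i + 1)) / 2 = c + 1 - i by omega]
    generalize a (c + 1) = x, a (c + 1 - i) = y, a (c + 2) = z, a (c - i) = t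
    revert x y z t
    decide

theorem wave_boundary {a : ℤ → ZMod 2} {m n : ℕ} (ha : ∀ k, a (-k) = a k)
    (hm : Function.Periodic a m) (hn : Function.Periodic a n) {i j : ℤ}
    (h : i = 0 ∨ i = m ∨ j = 0 ∨ j = n) : wave a i j = 0 := by
  unfold wave
  split_ifs with he
  swap
  · rfl
  obtain ⟨c, hc⟩ := he
  rw [show (i + j) / 2 = c by omega, show (j - i) / 2 = c - i by omega]
  rw [CharTwo.add_eq_zero]
  rcases h with rfl | rfl | rfl | rfl
  · simp
  · rw [hm.sub_eq]
  · rw [show c - i = -c by omega, ha]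
  · rw [show c - i = -(c - n) by omega, ha, hn.sub_eq]

/-- The black vertices of the grid at which `wave a` is nonzero. -/
def waveSet (p q : ℕ) (a : ℤ → ZMod 2) : Set (Fin p × Fin q) :=
  {v | wave a (v.1 + 1) (v.2 + 1) = 1}

theorem even_of_mem_waveSet {p q : ℕ} {a : ℤ → ZMod 2} {v : Fin p × Fin q}
    (hv : v ∈ waveSet p q a) : Even ((v.1 : ℕ) + (v.2 : ℕ)) := by
  simp only [waveSet, wave, Set.mem_ofPred_eq] at hv
  split_ifs at hv with h
  · rw [← Int.even_coe_nat]
    push_cast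
    grind
  · exact absurd hv (by decide)

theorem ind_waveSet {p q : ℕ} {a : ℤ → ZMod 2} (ha : ∀ k, a (-k) = a k)
    (hm : Function.Periodic a (p + 1 : ℕ)) (hn : Function.Periodic a (q + 1 : ℕ)) {i j : ℤ}
    (hi₀ : 0 ≤ i) (hi : i ≤ p + 1) (hj₀ : 0 ≤ j) (hj : j ≤ q + 1) :
    ind (waveSet p q a) i j = wave a i j := by
  by_cases hb : i = 0 ∨ i = (p + 1 : ℕ) ∨ j = 0 ∨ j = (q + 1 : ℕ)
  · rw [wave_boundary ha hm hn hb, ind_outside (by omega)]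
  · have arith : ∀ x y : ZMod 2, (x = 1 ↔ y = 1) → x = y := by decide
    obtain ⟨x, rfl⟩ : ∃ x : Fin p, i = x + 1 := ⟨⟨(i - 1).toNat, by omega⟩, by simp; omega⟩
    obtain ⟨y, rfl⟩ : ∃ y : Fin q, j = y + 1 := ⟨⟨(j - 1).toNat, by omega⟩, by simp; omega⟩
    exact arith _ _ (mem_iff_ind (v := (x, y))).symm

theorem isChannel_waveSet {p q : ℕ} {a : ℤ → ZMod 2} (ha : ∀ k, a (-k) = a k)
    (hm : Function.Periodic a (p + 1 : ℕ)) (hn : Function.Periodic a (q + 1 : ℕ)) :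
    IsChannel (gridGraph p q) (waveSet p q a) := by
  rw [isChannel_iff_ind]
  intro v
  have h₁ := v.1.isLt
  have h₂ := v.2.isLt
  rw [ind_waveSet ha hm hn, ind_waveSet ha hm hn, ind_waveSet ha hm hn, ind_waveSet ha hm hn,
    wave_eq] <;> omega

/-- The extension of the indicator function of `C` to the plane by reflections. -/
noncomputable def reflected {p q : ℕ} (C : Set (Fin p × Fin q)) (i j : ℤ) : ZMod 2 :=
  ind C (foldDist (2 * (p + 1)) i) (foldDist (2 * (q + 1)) j)

theorem reflected_eq_ind {p q : ℕ} (C : Set (Fin p × Fin q)) {i j : ℤ}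
    (hi₀ : 0 ≤ i) (hi : i ≤ p + 1) (hj₀ : 0 ≤ j) (hj : j ≤ q + 1) :
    reflected C i j = ind C i j := by
  rw [reflected, foldDist_of_two_mul_le hi₀ (by push_cast; omega),
    foldDist_of_two_mul_le hj₀ (by push_cast; omega)]

theorem reflected_wave {p q : ℕ} {C : Set (Fin p × Fin q)} (hC : IsChannel (gridGraph p q) C)
    (i j : ℤ) :
    reflected C (i - 1) j + reflected C (i + 1) j +
      (reflected C i (j - 1) + reflected C i (j + 1)) = 0 := by
  have hr₀ := foldDist_nonneg (2 * (p + 1)) i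
  have hs₀ := foldDist_nonneg (2 * (q + 1)) j
  have hr := two_mul_foldDist_le (M := 2 * (p + 1)) (by omega) i
  have hs := two_mul_foldDist_le (M := 2 * (q + 1)) (by omega) j
  push_cast at hr hs
  unfold reflected
  by_cases hi : foldDist (2 * (p + 1)) i = 0 ∨ foldDist (2 * (p + 1)) i = (p + 1 : ℕ)
  · rw [foldDist_neighbors_boundary hi, CharTwo.add_self_eq_zero,
      ind_outside (by omega), ind_outside (by omega), add_zero, add_zero]
  by_cases hj : foldDist (2 * (q + 1)) j = 0 ∨ foldDist (2 * (q + 1)) j = (q + 1 : ℕ)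
  · rw [foldDist_neighbors_boundary hj, CharTwo.add_self_eq_zero,
      ind_outside (by omega), ind_outside (by omega), add_zero, add_zero]
  rw [foldDist_neighbors_interior (fun x => ind C x (foldDist (2 * (q + 1)) j))
      (by omega) (by push_cast at *; omega),
    foldDist_neighbors_interior (fun y => ind C (foldDist (2 * (p + 1)) i) y)
      (by omega) (by push_cast at *; omega)]
  generalize foldDist (2 * (p + 1)) i = r at *
  generalize foldDist (2 * (q + 1)) j = s at *
  obtain ⟨x, rfl⟩ : ∃ x : Fin p, r = x + 1 := ⟨⟨(r - 1).toNat, by omega⟩, by simp; omega⟩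
  obtain ⟨y, rfl⟩ : ∃ y : Fin q, s = y + 1 := ⟨⟨(s - 1).toNat, by omega⟩, by simp; omega⟩
  have := (isChannel_iff_ind C).mp hC (x, y)
  simpa [add_assoc, one_add_one_eq_two] using this

/-- The profile of `C`, read off along the diagonal. -/
noncomputable def profile {p q : ℕ} (C : Set (Fin p × Fin q)) (k : ℤ) : ZMod 2 :=
  reflected C k k

theorem reflected_boundary {p q : ℕ} (C : Set (Fin p × Fin q)) {i j : ℤ}
    (h : i = 0 ∨ i = (p + 1 : ℕ) ∨ j = 0 ∨ j = (q + 1 : ℕ)) : reflected C i j = 0 := by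
  apply ind_outside
  rcases h with h | h | h | h
  on_goal 1 => have := foldDist_of_two_mul_le (M := 2 * (p + 1)) (r := i) (by omega) (by omega)
  on_goal 2 => have := foldDist_of_two_mul_le (M := 2 * (p + 1)) (r := i) (by omega) (by omega)
  on_goal 3 => have := foldDist_of_two_mul_le (M := 2 * (q + 1)) (r := j) (by omega) (by omega)
  on_goal 4 => have := foldDist_of_two_mul_le (M := 2 * (q + 1)) (r := j) (by omega) (by omega)
  all_goals omega

theorem profile_zero {p q : ℕ} (C : Set (Fin p × Fin q)) : profile C 0 = 0 :=
  reflected_boundary C (Or.inl rfl)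

theorem profile_neg {p q : ℕ} (C : Set (Fin p × Fin q)) (k : ℤ) :
    profile C (-k) = profile C k := by
  simp only [profile, reflected, foldDist_neg]

theorem reflected_eq_profile {p q : ℕ} {C : Set (Fin p × Fin q)}
    (hC : IsChannel (gridGraph p q) C) (x y : ℤ) :
    reflected C (x - y) (x + y) = profile C x + profile C y := by
  have := eq_add_of_wave (G := fun x y => reflected C (x - y) (x + y)) ?_ ?_ x y
  · simpa [profile] using this
  · intro x y
    have := reflected_wave hC (x - y) (x + y + 1)
    rw [← this]
    ring_nf
  · intro x
    exact reflected_boundary C (by omega)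

theorem profile_periodic_left {p q : ℕ} {C : Set (Fin p × Fin q)}
    (hC : IsChannel (gridGraph p q) C) : Function.Periodic (profile C) (p + 1 : ℕ) := by
  intro k
  rw [← CharTwo.add_eq_zero, ← reflected_eq_profile hC]
  exact reflected_boundary C (by omega)

theorem profile_periodic_right {p q : ℕ} {C : Set (Fin p × Fin q)}
    (hC : IsChannel (gridGraph p q) C) : Function.Periodic (profile C) (q + 1 : ℕ) := by
  intro k
  rw [← profile_neg C k, ← CharTwo.add_eq_zero, ← reflected_eq_profile hC]
  exact reflected_boundary C (by omega)

theorem waveSet_profile {p q : ℕ} {C : Set (Fin p × Fin q)}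
    (hC : IsChannel (gridGraph p q) C) (hb : ∀ v ∈ C, Even ((v.1 : ℕ) + (v.2 : ℕ))) :
    waveSet p q (profile C) = C := by
  ext v
  have h₁ := v.1.isLt
  have h₂ := v.2.isLt
  rw [mem_iff_ind (C := C), waveSet, Set.mem_ofPred_eq, wave]
  split_ifs with he
  · obtain ⟨c, hc⟩ := he
    rw [← reflected_eq_profile hC, ← reflected_eq_ind C (by omega) (by omega) (by omega) (by omega)]
    rw [show ((v.1 : ℤ) + 1 + (v.2 + 1)) / 2 - (v.2 + 1 - (v.1 + 1)) / 2 = v.1 + 1 by omega,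
      show ((v.1 : ℤ) + 1 + (v.2 + 1)) / 2 + (v.2 + 1 - (v.1 + 1)) / 2 = v.2 + 1 by omega]
  · rw [← mem_iff_ind]
    refine iff_of_false (by decide) fun hv => he ?_
    obtain ⟨c, hc⟩ := hb v hv
    exact ⟨c + 1, by omega⟩

theorem periodic_gcd {α : Type*} {a : ℤ → α} {m n : ℕ} (hm : Function.Periodic a m)
    (hn : Function.Periodic a n) : Function.Periodic a (Nat.gcd m n) := by
  rw [Nat.gcd_eq_gcd_ab, mul_comm, mul_comm (n : ℤ)]
  exact (hm.int_mul _).add_period (hn.int_mul _)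

/-- The even function of period `2 * h + 1` vanishing at `0` with prescribed values on
`1, …, h`. -/
def evenExtend {h : ℕ} (s : Fin h → ZMod 2) (k : ℤ) : ZMod 2 :=
  if hk : 0 < foldDist (2 * h + 1) k ∧ foldDist (2 * h + 1) k ≤ h then
    s ⟨(foldDist (2 * h + 1) k - 1).toNat, by omega⟩
  else 0

theorem evenExtend_neg {h : ℕ} (s : Fin h → ZMod 2) (k : ℤ) :
    evenExtend s (-k) = evenExtend s k := by
  simp only [evenExtend, foldDist_neg]

theorem evenExtend_periodic {h : ℕ} (s : Fin h → ZMod 2) :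
    Function.Periodic (evenExtend s) (2 * h + 1 : ℕ) := by
  intro k
  have := foldDist_add_mul (2 * h + 1) k 1
  rw [mul_one] at this
  simp only [evenExtend, this]

theorem evenExtend_zero {h : ℕ} (s : Fin h → ZMod 2) : evenExtend s 0 = 0 := by
  simp [evenExtend, foldDist]

theorem evenExtend_apply {h : ℕ} (s : Fin h → ZMod 2) (i : Fin h) :
    evenExtend s (i + 1) = s i := by
  have hi := i.isLt
  have : foldDist (2 * h + 1) (i + 1) = i + 1 :=
    foldDist_of_two_mul_le (by omega) (by push_cast; omega)
  simp only [evenExtend, this]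
  rw [dif_pos (by omega)]
  congr
  omega

theorem evenExtend_eq {h : ℕ} {a : ℤ → ZMod 2} (h0 : a 0 = 0) (ha : ∀ k, a (-k) = a k)
    (hp : Function.Periodic a (2 * h + 1 : ℕ)) :
    evenExtend (fun i : Fin h => a (i + 1)) = a := by
  funext k
  have h₀ := foldDist_nonneg (2 * h + 1) k
  have h₁ := two_mul_foldDist_le (M := 2 * h + 1) (by omega) k
  push_cast at h₁
  rw [← apply_foldDist ha hp k, evenExtend]
  split_ifs with hk
  · congr 1
    simp only
    omega
  · rw [show foldDist (2 * h + 1) k = 0 by omega, h0]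

/-- If `(m−1)(n−1)` is even, the number of channels of `R_{(m−1)×(n−1)}` consisting only
of black vertices (those `(i,j)` with `i+j` even) is `2^{(gcd(m,n)−1)/2}`. -/
theorem grid_black_channel_count (m n : ℕ) (hm : 1 ≤ m) (hn : 1 ≤ n)
    (h : Even ((m - 1) * (n - 1))) :
    Nat.card {C : Set (Fin (m - 1) × Fin (n - 1)) //
        IsChannel (gridGraph (m - 1) (n - 1)) C ∧
          ∀ v ∈ C, Even ((v.1 : ℕ) + (v.2 : ℕ))} =
      2 ^ ((Nat.gcd m n - 1) / 2) := by
  obtain ⟨p, rfl⟩ := Nat.exists_eq_add_of_le' hm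
  obtain ⟨q, rfl⟩ := Nat.exists_eq_add_of_le' hn
  simp only [Nat.add_sub_cancel] at h ⊢
  obtain ⟨d, hd⟩ : Odd (Nat.gcd (p + 1) (q + 1)) := by
    rw [← Nat.not_even_iff_odd, even_iff_two_dvd, Nat.dvd_gcd_iff]
    rw [Nat.even_mul] at h
    grind
  have hdp : 2 * d + 1 ∣ p + 1 := hd ▸ Nat.gcd_dvd_left _ _
  have hdq : 2 * d + 1 ∣ q + 1 := hd ▸ Nat.gcd_dvd_right _ _
  have hper : ∀ (s : Fin d → ZMod 2) {N : ℕ}, 2 * d + 1 ∣ N →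
      Function.Periodic (evenExtend s) N := by
    rintro s _ ⟨c, rfl⟩
    have := (evenExtend_periodic s).nat_mul c
    rwa [mul_comm, ← Nat.cast_mul] at this
  have hbij : Function.Bijective (fun s : Fin d → ZMod 2 =>
      (⟨waveSet p q (evenExtend s),
        isChannel_waveSet (evenExtend_neg s) (hper s hdp) (hper s hdq),
        fun _ => even_of_mem_waveSet⟩ :
        {C : Set (Fin p × Fin q) // IsChannel (gridGraph p q) C ∧
          ∀ v ∈ C, Even ((v.1 : ℕ) + (v.2 : ℕ))})) := by
    constructor
    · intro s t hst
      have hst : waveSet p q (evenExtend s) = waveSet p q (evenExtend t) := congrArg Subtype.val hst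
      have hval : ∀ (s : Fin d → ZMod 2) (i : Fin d),
          ind (waveSet p q (evenExtend s)) (i + 1) (i + 1) = s i := by
        intro s i
        have hi := i.isLt
        have := Nat.le_of_dvd (by omega) hdp
        have := Nat.le_of_dvd (by omega) hdq
        rw [ind_waveSet (evenExtend_neg s) (hper s hdp) (hper s hdq) (by omega) (by omega)
          (by omega) (by omega), wave, if_pos ⟨_, rfl⟩, sub_self, Int.zero_ediv, evenExtend_zero,
          add_zero, show ((i : ℤ) + 1 + (i + 1)) / 2 = i + 1 by omega, evenExtend_apply]
      funext i
      rw [← hval s, hst, hval]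
    · rintro ⟨C, hC, hb⟩
      have hp := periodic_gcd (profile_periodic_left hC) (profile_periodic_right hC)
      rw [hd] at hp
      refine ⟨fun i => profile C (i + 1), Subtype.ext ?_⟩
      simp only
      rw [evenExtend_eq (profile_zero C) (profile_neg C) hp, waveSet_profile hC hb]
  rw [hd]
  refine (Nat.card_eq_of_bijective _ hbij).symm.trans ?_
  simp
end
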